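/- Let (F, m, 1, ω^L, ω^R) be a conformal full field algebra. Then for every u ∈ F the commutator formulas [𝕐_f(ω^L; x₁, x̄₁), 𝕐_f(u; x₂, x̄₂)] = Res_{x₀} x₂^{−1} δ((x₁−x₀)/x₂) 𝕐_f(𝕐_f(ω^L; x₀, x̄₀)u; x₂, x̄₂) and [𝕐_f(ω^R; x₁, x̄₁), 𝕐_f(u; x₂, x̄₂)] = Res_{x̄₀} x̄₂^{−1} δ((x̄₁−x̄₀)/x̄₂) 𝕐_f(𝕐_f(ω^R; x₀, x̄₀)u; x₂, x̄₂) hold. -/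

import Mathlib

noncomputable section
open scoped BigOperators TensorProduct
open Complex

/-! ## General analytic helpers -/

/-- Binomial coefficient with complex argument. -/
def cchoose (a : ℂ) (k : ℕ) : ℂ := (∏ i ∈ Finset.range k, (a - (i : ℂ))) / (k.factorial : ℂ)

/-- The argument of a complex number, normalized to lie in `[0, 2π)`. -/
def argNN (z : ℂ) : ℝ := if 0 ≤ z.arg then z.arg else z.arg + 2 * Real.pi

/-- Logarithm with the branch `0 ≤ arg z < 2π` used in the paper. -/
def logNN (z : ℂ) : ℂ := (Real.log (‖z‖) : ℂ) + (argNN z : ℂ) * Complex.I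

/-- `z ^ w = e^{w log z}` with the branch `0 ≤ arg z < 2π`. -/
def cpowNN (z w : ℂ) : ℂ := Complex.exp (w * logNN z)

/-- `z̄ ^ w = e^{w conj (log z)}` with the branch `0 ≤ arg z < 2π`. -/
def cpowNNbar (z w : ℂ) : ℂ := Complex.exp (w * (starRingEnd ℂ) (logNN z))

/-- Wirtinger derivative `∂/∂z` of a function of one complex variable (viewed as a
smooth function of the real and imaginary parts). -/
def wdz (h : ℂ → ℂ) (z : ℂ) : ℂ :=
  (1 / 2 : ℂ) * (fderiv ℝ h z 1 - Complex.I * fderiv ℝ h z Complex.I)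

/-- Wirtinger derivative `∂/∂z̄`. -/
def wdzbar (h : ℂ → ℂ) (z : ℂ) : ℂ :=
  (1 / 2 : ℂ) * (fderiv ℝ h z 1 + Complex.I * fderiv ℝ h z Complex.I)

/-- The exponential `e^{c g}` of an operator `g`, applied to a vector, as a finite sum
(`finsum`); this is the honest exponential whenever `g` is locally nilpotent. -/
def funExp {V : Type} [AddCommGroup V] [Module ℂ V] (g : V → V) (c : ℂ) (x : V) : V :=
  ∑ᶠ j : ℕ, (c ^ j / (j.factorial : ℂ)) • g^[j] x

/-- Bilinearity of a complex-valued pairing. -/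
def IsBilinMap {V W : Type} [AddCommGroup V] [Module ℂ V] [AddCommGroup W] [Module ℂ W]
    (f : V → W → ℂ) : Prop :=
  (∀ x y z, f (x + y) z = f x z + f y z) ∧ (∀ (c : ℂ) x z, f (c • x) z = c * f x z) ∧
  (∀ x y z, f x (y + z) = f x y + f x z) ∧ (∀ (c : ℂ) x y, f x (c • y) = c * f x y)

/-- Two local branches are adjacent if they agree on some nonempty open set. -/
def BranchAdj {E : Type} [TopologicalSpace E] (B : Set (Set E × (E → ℂ)))
    (b b' : Set E × (E → ℂ)) : Prop :=
  b ∈ B ∧ b' ∈ B ∧ ∃ U : Set E, IsOpen U ∧ U.Nonempty ∧ U ⊆ b.1 ∩ b'.1 ∧ Set.EqOn b.2 b'.2 U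

/-- The square root `√|z| e^{i arg z/2}` (argument normalized to `[0,2π)`). -/
def csqrt (z : ℂ) : ℂ := (Real.sqrt (‖z‖) : ℂ) * Complex.exp (Complex.I * (argNN z) / 2)

/-! ## ℝ-graded spaces with algebraic completions and graded duals -/

/-- An ℝ-graded vector space, presented through its family of grade projections. -/
structure GradedSpace where
  F : Type
  [grp : AddCommGroup F]
  [mod : Module ℂ F]
  P : ℝ → Module.End ℂ F
  P_orth : ∀ r s x, P r (P s x) = if r = s then P s x else 0
  P_finite : ∀ x : F, {r : ℝ | P r x ≠ 0}.Finite
  P_total : ∀ x : F, (∑ᶠ r, P r x) = x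

attribute [instance] GradedSpace.grp GradedSpace.mod

namespace GradedSpace

variable (G : GradedSpace)

/-- The algebraic completion `F̄ = ∏_r F_(r)`; we record an element of the completion by
its family of graded components. -/
abbrev Fbar := ℝ → G.F

/-- The inclusion of `F` into its algebraic completion. -/
def incl (x : G.F) : G.Fbar := fun r => G.P r x

/-- The graded dual `F'`: linear functionals supported on finitely many graded pieces. -/
def Dual := {f : G.F →ₗ[ℂ] ℂ // {r : ℝ | f ∘ₗ G.P r ≠ 0}.Finite}

/-- The canonical pairing between the graded dual and the algebraic completion. -/
def dpair (f : G.Dual) (g : G.Fbar) : ℂ := ∑ᶠ r, f.1 (g r)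

/-- The total grading operator `d` (multiplication by `r` on the grade-`r` piece). -/
def dop (x : G.F) : G.F := ∑ᶠ r : ℝ, (r : ℂ) • G.P r x

/-- The operator `e^{a d}`. -/
def expd (a : ℝ) (x : G.F) : G.F := ∑ᶠ r, (Real.exp (a * r) : ℂ) • G.P r x

end GradedSpace
/-! ## Full field algebras (Definition 1.1 of Huang–Kong) -/

/-- A full field algebra: an ℝ-graded vector space together with correlation function
maps `m_n` and a vacuum, satisfying the axioms of Definition 1.1 of Huang–Kong
(multilinearity and smoothness, normalization of `m₁`, the vacuum property, absolute
convergence of substituted series, the permutation property, and the `e^{a d}`-grading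
property).  Absolute convergence of series in the completion is expressed through the
pairing with arbitrary elements of the graded dual. -/
structure FullFieldAlgebra where
  g : GradedSpace
  m : ∀ n : ℕ, (Fin n → g.F) → (Fin n → ℂ) → g.Fbar
  vac : g.F
  m_graded : ∀ n u z r, g.P r (m n u z r) = m n u z r
  m_add : ∀ n (u : Fin n → g.F) (i : Fin n) (x y : g.F) (z : Fin n → ℂ),
    m n (Function.update u i (x + y)) z
      = m n (Function.update u i x) z + m n (Function.update u i y) z
  m_smul : ∀ n (u : Fin n → g.F) (i : Fin n) (c : ℂ) (x : g.F) (z : Fin n → ℂ),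
    m n (Function.update u i (c • x)) z = c • m n (Function.update u i x) z
  m_smooth : ∀ n (u : Fin n → g.F) (f : g.Dual),
    ContDiffOn ℝ (⊤ : ℕ∞) (fun z : Fin n → ℂ => g.dpair f (m n u z))
      {z : Fin n → ℂ | Function.Injective z}
  m_one : ∀ u : g.F, m 1 (fun _ => u) (fun _ => 0) = g.incl u
  m_vac : ∀ n (u : Fin n → g.F) (z : Fin n → ℂ) (w : ℂ),
    m (n + 1) (Fin.snoc u vac) (Fin.snoc z w) = m n u z
  m_perm : ∀ n (σ : Equiv.Perm (Fin n)) (u : Fin n → g.F) (z : Fin n → ℂ),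
    m n (fun i => u (σ i)) (fun i => z (σ i)) = m n u z
  m_conv : ∀ (k : ℕ) (l : Fin k → ℕ) (u : ∀ i, Fin (l i) → g.F)
    (z0 : Fin k → ℂ) (z : ∀ i, Fin (l i) → ℂ)
    (e : (Σ i : Fin k, Fin (l i)) ≃ Fin (∑ i, l i)),
    (∀ i j, i ≠ j → ∀ (p : Fin (l i)) (q : Fin (l j)),
      ‖z i p‖ + ‖z j q‖ < ‖z0 i - z0 j‖) →
    ∀ f : g.Dual,
      Summable (fun r : Fin k → ℝ =>
        ‖g.dpair f (m k (fun i => m (l i) (u i) (z i) (r i)) z0)‖) ∧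
      (∑' r : Fin k → ℝ,
          g.dpair f (m k (fun i => m (l i) (u i) (z i) (r i)) z0))
        = g.dpair f (m (∑ i, l i)
            (fun j => u (e.symm j).1 (e.symm j).2)
            (fun j => z (e.symm j).1 (e.symm j).2 + z0 (e.symm j).1))
  m_grading : ∀ (a : ℝ) n (u : Fin n → g.F) (z : Fin n → ℂ) (r : ℝ),
    g.expd a (m n u z r)
      = m n (fun i => g.expd a (u i)) (fun i => Real.exp a • z i) r

namespace FullFieldAlgebra

variable (Φ : FullFieldAlgebra)

/-- The full vertex operator map `𝕐(u; z, z̄)v = m₂(u ⊗ v; z, z̄, 0, 0)`, with values in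
the algebraic completion. -/
def Y (u : Φ.g.F) (z : ℂ) (v : Φ.g.F) : Φ.g.Fbar := Φ.m 2 ![u, v] ![z, 0]

end FullFieldAlgebra

/-- Iterated products `𝕐(u₁; z₁)⋯𝕐(u_k; z_k)𝟏` with prescribed graded components at
every intermediate stage. -/
def FullFieldAlgebra.chain (Φ : FullFieldAlgebra) :
    ∀ k : ℕ, (Fin k → Φ.g.F) → (Fin k → ℂ) → (Fin k → ℝ) → Φ.g.F
  | 0, _, _, _ => Φ.vac
  | (k + 1), u, z, r =>
      Φ.Y (u 0) (z 0)
        (FullFieldAlgebra.chain Φ k (fun i => u i.succ) (fun i => z i.succ)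
          (fun i => r i.succ)) (r 0)

/-! ## ℝ×ℝ-graded full field algebras (Definition 1.5 of Huang–Kong) -/

/-- An ℝ×ℝ-graded full field algebra: a full field algebra with a compatible double
grading, operators `D^L, D^R`, the single-valuedness property, a strengthened
convergence property, and the `d`-bracket and `D`-derivative properties. -/
structure RxRFFA extends FullFieldAlgebra where
  PLR : ℝ → ℝ → Module.End ℂ g.F
  PLR_orth : ∀ p q p' q' x, PLR p q (PLR p' q' x) = if p = p' ∧ q = q' then PLR p' q' x else 0
  PLR_finite : ∀ x, {pq : ℝ × ℝ | PLR pq.1 pq.2 x ≠ 0}.Finite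
  PLR_total : ∀ (r : ℝ) (x : g.F), g.P r x = ∑ᶠ p : ℝ, PLR p (r - p) x
  dLop : Module.End ℂ g.F
  dRop : Module.End ℂ g.F
  dLop_eq : ∀ p q x, dLop (PLR p q x) = (p : ℂ) • PLR p q x
  dRop_eq : ∀ p q x, dRop (PLR p q x) = (q : ℂ) • PLR p q x
  DL : Module.End ℂ g.F
  DR : Module.End ℂ g.F
  single_valued : ∀ (p q : ℝ) (x : g.F),
    Complex.exp (((2 * Real.pi : ℝ) : ℂ) * Complex.I * ((p : ℂ) - (q : ℂ))) • PLR p q x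
      = PLR p q x
  m_conv2 : ∀ (k : ℕ) (l : Fin k → ℕ) (u : ∀ i, Fin (l i) → g.F)
    (z0 : Fin k → ℂ) (z : ∀ i, Fin (l i) → ℂ)
    (e : (Σ i : Fin k, Fin (l i)) ≃ Fin (∑ i, l i)),
    (∀ i j, i ≠ j → ∀ (p : Fin (l i)) (q : Fin (l j)),
      ‖z i p‖ + ‖z j q‖ < ‖z0 i - z0 j‖) →
    ∀ f : g.Dual,
      Summable (fun r : Fin k → ℝ × ℝ =>
        ‖g.dpair f (m k (fun i =>
            PLR (r i).1 (r i).2 (m (l i) (u i) (z i) ((r i).1 + (r i).2))) z0)‖) ∧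
      (∑' r : Fin k → ℝ × ℝ,
          g.dpair f (m k (fun i =>
            PLR (r i).1 (r i).2 (m (l i) (u i) (z i) ((r i).1 + (r i).2))) z0))
        = g.dpair f (m (∑ i, l i)
            (fun j => u (e.symm j).1 (e.symm j).2)
            (fun j => z (e.symm j).1 (e.symm j).2 + z0 (e.symm j).1))
  dL_bracket : ∀ (u v : g.F) (f : g.Dual) (z : ℂ), z ≠ 0 →
    g.dpair f (fun r => dLop (toFullFieldAlgebra.Y u z v r))
      - g.dpair f (toFullFieldAlgebra.Y u z (dLop v))
    = z * wdz (fun w => g.dpair f (toFullFieldAlgebra.Y u w v)) z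
      + g.dpair f (toFullFieldAlgebra.Y (dLop u) z v)
  dR_bracket : ∀ (u v : g.F) (f : g.Dual) (z : ℂ), z ≠ 0 →
    g.dpair f (fun r => dRop (toFullFieldAlgebra.Y u z v r))
      - g.dpair f (toFullFieldAlgebra.Y u z (dRop v))
    = (starRingEnd ℂ z) * wdzbar (fun w => g.dpair f (toFullFieldAlgebra.Y u w v)) z
      + g.dpair f (toFullFieldAlgebra.Y (dRop u) z v)
  DL_deriv : ∀ (u v : g.F) (f : g.Dual) (z : ℂ), z ≠ 0 →
    g.dpair f (toFullFieldAlgebra.Y (DL u) z v)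
      = wdz (fun w => g.dpair f (toFullFieldAlgebra.Y u w v)) z
  DL_comm : ∀ (u v : g.F) (f : g.Dual) (z : ℂ), z ≠ 0 →
    g.dpair f (fun r => DL (toFullFieldAlgebra.Y u z v r))
        - g.dpair f (toFullFieldAlgebra.Y u z (DL v))
      = g.dpair f (toFullFieldAlgebra.Y (DL u) z v)
  DR_deriv : ∀ (u v : g.F) (f : g.Dual) (z : ℂ), z ≠ 0 →
    g.dpair f (toFullFieldAlgebra.Y (DR u) z v)
      = wdzbar (fun w => g.dpair f (toFullFieldAlgebra.Y u w v)) z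
  DR_comm : ∀ (u v : g.F) (f : g.Dual) (z : ℂ), z ≠ 0 →
    g.dpair f (fun r => DR (toFullFieldAlgebra.Y u z v r))
        - g.dpair f (toFullFieldAlgebra.Y u z (DR v))
      = g.dpair f (toFullFieldAlgebra.Y (DR u) z v)

namespace RxRFFA

variable (Φ : RxRFFA)

/-- The coefficient `𝕐_{l,r}(u)v` of `x^{-l-1} x̄^{-r-1}` in the formal full vertex
operator `𝕐_f(u; x, x̄)v`, extracted from `𝕐(·; 1, 1)` by bigraded components. -/
def Ymode (u : Φ.g.F) (l r : ℝ) (v : Φ.g.F) : Φ.g.F :=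
  ∑ᶠ a : ℝ, ∑ᶠ b : ℝ, ∑ᶠ c : ℝ, ∑ᶠ d : ℝ,
    Φ.PLR (a + c - l - 1) (b + d - r - 1)
      (Φ.toFullFieldAlgebra.Y (Φ.PLR a b u) 1 (Φ.PLR c d v) ((a + c - l - 1) + (b + d - r - 1)))

/-- The coefficient `𝕐_{n-1}(u)v` of `x^{-n-1}` in the diagonal formal vertex operator
`𝕐_f(u; x, x)v` (sum of `𝕐_{l,r}` over `l + r + 1 = n`). -/
def diagMode (u : Φ.g.F) (n : ℝ) (v : Φ.g.F) : Φ.g.F :=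
  ∑ᶠ l : ℝ, Φ.Ymode u l (n - 1 - l) v

/-- A term of the double series expansion of
`⟨w', 𝕐_an(u; z₁, ζ₁) 𝕐_an(v; z₂, ζ₂) w⟩` (a product of analytic full vertex
operators). -/
def prodTerm (f : Φ.g.Dual) (u v w : Φ.g.F) (z1 ζ1 z2 ζ2 : ℂ)
    (p : (ℝ × ℝ) × ℝ × ℝ) : ℂ :=
  cpowNN z1 (-(p.1.1 : ℂ) - 1) * cpowNNbar ζ1 (-(p.1.2 : ℂ) - 1) *
  cpowNN z2 (-(p.2.1 : ℂ) - 1) * cpowNNbar ζ2 (-(p.2.2 : ℂ) - 1) *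
  f.1 (Φ.Ymode u p.1.1 p.1.2 (Φ.Ymode v p.2.1 p.2.2 w))

/-- A term of the double series expansion of
`⟨w', 𝕐_an(𝕐_an(u; z₁-z₂, ζ₁-ζ₂)v; z₂, ζ₂) w⟩` (an iterate of analytic full vertex
operators). -/
def iterTerm (f : Φ.g.Dual) (u v w : Φ.g.F) (z1 ζ1 z2 ζ2 : ℂ)
    (p : (ℝ × ℝ) × ℝ × ℝ) : ℂ :=
  cpowNN (z1 - z2) (-(p.1.1 : ℂ) - 1) * cpowNNbar (ζ1 - ζ2) (-(p.1.2 : ℂ) - 1) *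
  cpowNN z2 (-(p.2.1 : ℂ) - 1) * cpowNNbar ζ2 (-(p.2.2 : ℂ) - 1) *
  f.1 (Φ.Ymode (Φ.Ymode u p.1.1 p.1.2 v) p.2.1 p.2.2 w)

/-- Grading restriction: double weights bounded below and finite-dimensional doubly
homogeneous subspaces. -/
def GradingRestricted : Prop :=
  (∃ M : ℝ, ∀ p q, (p < M ∨ q < M) → Φ.PLR p q = 0) ∧
  ∀ p q, Module.Finite ℂ (LinearMap.range (Φ.PLR p q))

/-- The diagonal operator acting by `fL p * fR q` on the bigraded piece of bidegree
`(p, q)`; used for operators such as `z^{-2L^L(0)} z̄^{-2L^R(0)} e^{±πi L^{L,R}(0)}`. -/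
def diagExp (fL fR : ℝ → ℂ) (x : Φ.g.F) : Φ.g.F :=
  ∑ᶠ p : ℝ, ∑ᶠ q : ℝ, (fL p * fR q) • Φ.PLR p q x

end RxRFFA

/-- Iterated mode compositions `𝕐_{l₁,r₁}(u₁)⋯𝕐_{l_k,r_k}(u_k)𝟏`. -/
def RxRFFA.chainMode (Φ : RxRFFA) : ∀ k : ℕ, (Fin k → Φ.g.F) → (Fin k → ℝ × ℝ) → Φ.g.F
  | 0, _, _ => Φ.vac
  | (k + 1), u, R =>
      Φ.Ymode (u 0) (R 0).1 (R 0).2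
        (RxRFFA.chainMode Φ k (fun i => u i.succ) (fun i => R i.succ))

/-! ## Conformal full field algebras -/

/-- A conformal full field algebra of central charges `(c^L, c^R)`. -/
structure ConfFFA extends RxRFFA where
  cL : ℂ
  cR : ℂ
  ωL : g.F
  ωR : g.F
  grading_res : toRxRFFA.GradingRestricted
  ωL_modes : ∀ (l r : ℝ), (¬ (r = -1 ∧ ∃ n : ℤ, l = (n : ℝ) + 1)) →
    ∀ v, toRxRFFA.Ymode ωL l r v = 0
  ωR_modes : ∀ (l r : ℝ), (¬ (l = -1 ∧ ∃ n : ℤ, r = (n : ℝ) + 1)) →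
    ∀ v, toRxRFFA.Ymode ωR l r v = 0
  LL : ℤ → Module.End ℂ g.F
  LR : ℤ → Module.End ℂ g.F
  LL_eq : ∀ (n : ℤ) v, LL n v = toRxRFFA.Ymode ωL ((n : ℝ) + 1) (-1) v
  LR_eq : ∀ (n : ℤ) v, LR n v = toRxRFFA.Ymode ωR (-1) ((n : ℝ) + 1) v
  virL : ∀ (mm nn : ℤ) (v : g.F),
    LL mm (LL nn v) - LL nn (LL mm v)
      = ((mm - nn : ℤ) : ℂ) • LL (mm + nn) v
        + (if mm + nn = 0 then (cL / 12) * ((mm : ℂ) ^ 3 - (mm : ℂ)) else 0) • v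
  virR : ∀ (mm nn : ℤ) (v : g.F),
    LR mm (LR nn v) - LR nn (LR mm v)
      = ((mm - nn : ℤ) : ℂ) • LR (mm + nn) v
        + (if mm + nn = 0 then (cR / 12) * ((mm : ℂ) ^ 3 - (mm : ℂ)) else 0) • v
  virLR : ∀ (mm nn : ℤ) (v : g.F), LL mm (LR nn v) = LR nn (LL mm v)
  dL_L0 : ∀ v, dLop v = LL 0 v
  dR_L0 : ∀ v, dRop v = LR 0 v
  DL_L1 : ∀ v, DL v = LL (-1) v
  DR_L1 : ∀ v, DR v = LR (-1) v
/-! ## Vertex operator algebras (in mode form) -/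

/-- A vertex operator algebra, presented through the modes `u_n = (Y u) n` of its vertex
operators, with the grading, vacuum, creation, `L(-1)`-derivative, Virasoro and
Borcherds-identity axioms. -/
structure VOA where
  V : Type
  [grp : AddCommGroup V]
  [mod : Module ℂ V]
  P : ℤ → Module.End ℂ V
  P_orth : ∀ m n x, P m (P n x) = if m = n then P n x else 0
  P_finite : ∀ x : V, {n : ℤ | P n x ≠ 0}.Finite
  P_total : ∀ x : V, (∑ᶠ n, P n x) = x
  P_lower : ∃ N : ℤ, ∀ n < N, P n = 0
  P_findim : ∀ n, Module.Finite ℂ (LinearMap.range (P n))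
  Yop : V → ℤ → Module.End ℂ V
  Y_add : ∀ u u' n, Yop (u + u') n = Yop u n + Yop u' n
  Y_smul : ∀ (c : ℂ) u n, Yop (c • u) n = c • Yop u n
  one : V
  ω : V
  cc : ℂ
  trunc : ∀ u v, ∃ N : ℤ, ∀ n ≥ N, Yop u n v = 0
  vac_id : ∀ n, Yop one n = if n = -1 then 1 else 0
  creation_neg1 : ∀ u, Yop u (-1) one = u
  creation_pos : ∀ u n, 0 ≤ n → Yop u n one = 0
  L0_grading : ∀ (n : ℤ) x, Yop ω 1 (P n x) = (n : ℂ) • P n x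
  Lm1_deriv : ∀ u n, Yop (Yop ω 0 u) n = (-(n : ℂ)) • Yop u (n - 1)
  virasoro : ∀ (m n : ℤ) (v : V),
    Yop ω (m + 1) (Yop ω (n + 1) v) - Yop ω (n + 1) (Yop ω (m + 1) v)
      = ((m - n : ℤ) : ℂ) • Yop ω (m + n + 1) v
        + (if m + n = 0 then (cc / 12) * ((m : ℂ) ^ 3 - (m : ℂ)) else 0) • v
  borcherds : ∀ (u v w : V) (p q r : ℤ),
    (∑ᶠ i : ℕ, cchoose (p : ℂ) i • Yop (Yop u (r + i) v) (p + q - i) w)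
      = ∑ᶠ i : ℕ, ((-1 : ℂ) ^ i * cchoose (r : ℂ) i) •
          (Yop u (p + r - i) (Yop v (q + i) w)
            - (-1 : ℂ) ^ r • Yop v (q + r - i) (Yop u (p + i) w))

attribute [instance] VOA.grp VOA.mod

namespace VOA

variable (A : VOA)

/-- Simplicity of a vertex operator algebra: no nonzero proper ideals. -/
def IsSimple : Prop :=
  Nontrivial A.V ∧
    ∀ S : Submodule ℂ A.V, (∀ u n x, x ∈ S → A.Yop u n x ∈ S) → S = ⊥ ∨ S = ⊤

/-- The subspace `C₂(V)` spanned by the `u_{-2} v`. -/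
def C2 : Submodule ℂ A.V := Submodule.span ℂ {x | ∃ u v, x = A.Yop u (-2) v}

/-- `C₂`-cofiniteness. -/
def C2Cofinite : Prop := Module.Finite ℂ (A.V ⧸ A.C2)

end VOA

/-! ## Generalized (ℂ-graded), weak, and ordinary (ℝ-graded) modules -/

/-- A ℂ-graded generalized module for a vertex operator algebra: `L(0)` acts on each
graded piece with a single generalized eigenvalue. -/
structure GenModule (A : VOA) where
  W : Type
  [grp : AddCommGroup W]
  [mod : Module ℂ W]
  P : ℂ → Module.End ℂ W
  P_orth : ∀ m n x, P m (P n x) = if m = n then P n x else 0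
  P_finite : ∀ x : W, {n : ℂ | P n x ≠ 0}.Finite
  P_total : ∀ x : W, (∑ᶠ n, P n x) = x
  act : A.V → ℤ → Module.End ℂ W
  act_add : ∀ u u' n, act (u + u') n = act u n + act u' n
  act_smul : ∀ (c : ℂ) u n, act (c • u) n = c • act u n
  trunc : ∀ u w, ∃ N : ℤ, ∀ n ≥ N, act u n w = 0
  vac_id : ∀ n, act A.one n = if n = -1 then 1 else 0
  L0_gen : ∀ (n : ℂ) (x : W), ∃ k : ℕ,
    ((act A.ω 1 - n • (1 : Module.End ℂ W)) ^ k) (P n x) = 0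
  borcherds : ∀ (u v : A.V) (w : W) (p q r : ℤ),
    (∑ᶠ i : ℕ, cchoose (p : ℂ) i • act (A.Yop u (r + i) v) (p + q - i) w)
      = ∑ᶠ i : ℕ, ((-1 : ℂ) ^ i * cchoose (r : ℂ) i) •
          (act u (p + r - i) (act v (q + i) w)
            - (-1 : ℂ) ^ r • act v (q + r - i) (act u (p + i) w))

attribute [instance] GenModule.grp GenModule.mod

namespace GenModule

variable {A : VOA} (M : GenModule A)

/-- Submodules (subrepresentations) of a generalized module. -/
def IsSubrep (S : Submodule ℂ M.W) : Prop := ∀ u n x, x ∈ S → M.act u n x ∈ S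

/-- Irreducibility of a generalized module. -/
def IsIrred : Prop :=
  (∃ x : M.W, x ≠ 0) ∧ ∀ S : Submodule ℂ M.W, M.IsSubrep S → S = ⊥ ∨ S = ⊤

/-- A generalized module is ℝ-graded if all its weights are real. -/
def RealGraded : Prop := ∀ n : ℂ, M.P n ≠ 0 → n.im = 0

/-- Isomorphism of generalized modules. -/
def Iso (N : GenModule A) : Prop :=
  ∃ e : M.W ≃ₗ[ℂ] N.W, ∀ u n x, e (M.act u n x) = N.act u n (e x)

/-- A generalized module is equivalent to the adjoint module `V` itself. -/
def IsoAdjoint : Prop :=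
  ∃ e : M.W ≃ₗ[ℂ] A.V, ∀ u n x, e (M.act u n x) = A.Yop u n (e x)

/-- The subspace `C₁(W)` spanned by `u_{-1} w` for `u ∈ V₊`. -/
def C1 : Submodule ℂ M.W :=
  Submodule.span ℂ
    {y | ∃ (u : A.V) (w : M.W), (∃ n : ℤ, 0 < n ∧ A.P n u = u) ∧ y = M.act u (-1) w}

/-- `C₁`-cofiniteness of a generalized module. -/
def C1Cofinite : Prop := Module.Finite ℂ (M.W ⧸ M.C1)

end GenModule

/-- A weak module: only the action axioms, with no grading. -/
structure WeakModule (A : VOA) where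
  W : Type
  [grp : AddCommGroup W]
  [mod : Module ℂ W]
  act : A.V → ℤ → Module.End ℂ W
  act_add : ∀ u u' n, act (u + u') n = act u n + act u' n
  act_smul : ∀ (c : ℂ) u n, act (c • u) n = c • act u n
  trunc : ∀ u w, ∃ N : ℤ, ∀ n ≥ N, act u n w = 0
  vac_id : ∀ n, act A.one n = if n = -1 then 1 else 0
  borcherds : ∀ (u v : A.V) (w : W) (p q r : ℤ),
    (∑ᶠ i : ℕ, cchoose (p : ℂ) i • act (A.Yop u (r + i) v) (p + q - i) w)
      = ∑ᶠ i : ℕ, ((-1 : ℂ) ^ i * cchoose (r : ℂ) i) •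
          (act u (p + r - i) (act v (q + i) w)
            - (-1 : ℂ) ^ r • act v (q + r - i) (act u (p + i) w))

attribute [instance] WeakModule.grp WeakModule.mod

namespace WeakModule

variable {A : VOA} (M : WeakModule A)

/-- ℕ-gradability of a weak module. -/
def NGradable : Prop :=
  ∃ Q : ℕ → Module.End ℂ M.W,
    (∀ m n x, Q m (Q n x) = if m = n then Q n x else 0) ∧
    (∀ x : M.W, {n : ℕ | Q n x ≠ 0}.Finite) ∧
    (∀ x : M.W, (∑ᶠ n, Q n x) = x) ∧
    (∀ (mw : ℤ) (u : A.V), A.P mw u = u →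
      ∀ (n : ℤ) (k j : ℕ) (x : M.W), (j : ℤ) ≠ (k : ℤ) + mw - n - 1 →
        Q j (M.act u n (Q k x)) = 0)

/-- Subrepresentations of a weak module. -/
def IsSubrep (S : Submodule ℂ M.W) : Prop := ∀ u n x, x ∈ S → M.act u n x ∈ S

/-- Complete reducibility of a weak module. -/
def CompleteReducible : Prop :=
  ∃ (ι : Type) (S : ι → Submodule ℂ M.W),
    (∀ i, M.IsSubrep (S i)) ∧
    (∀ i, S i ≠ ⊥ ∧ ∀ T : Submodule ℂ M.W, M.IsSubrep T → T ≤ S i → T = ⊥ ∨ T = S i) ∧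
    (∀ i, Disjoint (S i) (⨆ (j) (_ : j ≠ i), S j)) ∧
    (⨆ i, S i) = ⊤

end WeakModule

/-- An ordinary (ℝ-graded, grading-restricted) module for a vertex operator algebra. -/
structure VModule (A : VOA) where
  W : Type
  [grp : AddCommGroup W]
  [mod : Module ℂ W]
  P : ℝ → Module.End ℂ W
  P_orth : ∀ m n x, P m (P n x) = if m = n then P n x else 0
  P_finite : ∀ x : W, {n : ℝ | P n x ≠ 0}.Finite
  P_total : ∀ x : W, (∑ᶠ n, P n x) = x
  P_lower : ∃ h : ℝ, ∀ r < h, P r = 0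
  P_findim : ∀ r, Module.Finite ℂ (LinearMap.range (P r))
  act : A.V → ℤ → Module.End ℂ W
  act_add : ∀ u u' n, act (u + u') n = act u n + act u' n
  act_smul : ∀ (c : ℂ) u n, act (c • u) n = c • act u n
  trunc : ∀ u w, ∃ N : ℤ, ∀ n ≥ N, act u n w = 0
  vac_id : ∀ n, act A.one n = if n = -1 then 1 else 0
  L0_grading : ∀ (r : ℝ) (x : W), act A.ω 1 (P r x) = (r : ℂ) • P r x
  borcherds : ∀ (u v : A.V) (w : W) (p q r : ℤ),
    (∑ᶠ i : ℕ, cchoose (p : ℂ) i • act (A.Yop u (r + i) v) (p + q - i) w)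
      = ∑ᶠ i : ℕ, ((-1 : ℂ) ^ i * cchoose (r : ℂ) i) •
          (act u (p + r - i) (act v (q + i) w)
            - (-1 : ℂ) ^ r • act v (q + r - i) (act u (p + i) w))

attribute [instance] VModule.grp VModule.mod

namespace VModule

variable {A : VOA} (M : VModule A)

/-- Subrepresentations of an ordinary module. -/
def IsSubrep (S : Submodule ℂ M.W) : Prop := ∀ u n x, x ∈ S → M.act u n x ∈ S

/-- Irreducibility of an ordinary module. -/
def IsIrred : Prop :=
  (∃ x : M.W, x ≠ 0) ∧ ∀ S : Submodule ℂ M.W, M.IsSubrep S → S = ⊥ ∨ S = ⊤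

/-- Isomorphism of ordinary modules. -/
def Iso (N : VModule A) : Prop :=
  ∃ e : M.W ≃ₗ[ℂ] N.W, ∀ u n x, e (M.act u n x) = N.act u n (e x)

/-- The graded dual of an ordinary module. -/
def Dual := {φ : M.W →ₗ[ℂ] ℂ // {r : ℝ | φ ∘ₗ M.P r ≠ 0}.Finite}

/-- The operator `e^{-L(1)}` (`w ↦ w̃` in the paper). -/
def expL1neg (w : M.W) : M.W :=
  ∑ᶠ j : ℕ, ((-1 : ℂ) ^ j / (j.factorial : ℂ)) • ((M.act A.ω 2) ^ j) w

/-- The operator `x^{L(0)}` for a real `x`, acting diagonally on the grading. -/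
def rL0 (x : ℝ) (w : M.W) : M.W := ∑ᶠ h : ℝ, ((Real.rpow x h : ℝ) : ℂ) • M.P h w

end VModule

namespace VOA

variable (A : VOA)

/-- Condition (i) on `V^L, V^R`: every ℂ-graded generalized module is a direct sum of
irreducible ones. -/
def CondI : Prop :=
  ∀ M : GenModule A, ∃ (ι : Type) (S : ι → Submodule ℂ M.W),
    (∀ i, M.IsSubrep (S i)) ∧
    (∀ i, S i ≠ ⊥ ∧ ∀ T : Submodule ℂ M.W, M.IsSubrep T → T ≤ S i → T = ⊥ ∨ T = S i) ∧
    (∀ i, Disjoint (S i) (⨆ (j) (_ : j ≠ i), S j)) ∧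
    (⨆ i, S i) = ⊤

/-- Condition (ii): finitely many inequivalent ℂ-graded irreducible modules, all
ℝ-graded. -/
def CondII : Prop :=
  ∃ (k : ℕ) (Ms : Fin k → GenModule A),
    (∀ i, (Ms i).IsIrred ∧ (Ms i).RealGraded) ∧
    ∀ M : GenModule A, M.IsIrred → ∃ i, M.Iso (Ms i)

/-- Condition (iii): every ℝ-graded irreducible module is `C₁`-cofinite. -/
def CondIII : Prop := ∀ M : GenModule A, M.IsIrred → M.RealGraded → M.C1Cofinite

/-- The three conditions (i)–(iii) of Section 2 of Huang–Kong. -/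
def Conds : Prop := A.CondI ∧ A.CondII ∧ A.CondIII

/-- Condition (i) of Section 3: positive energy, `V_(0) = ℂ𝟏`, and `W_(0) = 0` for
irreducible modules not equivalent to `V`. -/
def CondA : Prop :=
  (∀ n : ℤ, n < 0 → A.P n = 0) ∧
  (∀ x : A.V, A.P 0 x = x → ∃ c : ℂ, x = c • A.one) ∧
  (∀ M : GenModule A, M.IsIrred → ¬ M.IsoAdjoint → M.P 0 = 0)

/-- Condition (ii) of Section 3: every ℕ-gradable weak module is completely
reducible. -/
def CondB : Prop := ∀ M : WeakModule A, M.NGradable → M.CompleteReducible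

/-- The conditions of Section 3 of Huang–Kong on the vertex operator algebra `V`:
simplicity together with conditions (i)–(iii). -/
def CondsV : Prop := A.IsSimple ∧ A.CondA ∧ A.CondB ∧ A.C2Cofinite

end VOA
/-! ## Intertwining operators -/

/-- The ambient space of candidate intertwining operators of type `(W₃; W₁ W₂)`:
mode families `w₁ ↦ (n ↦ (w₂ ↦ 𝒴(w₁)_n w₂))`. -/
abbrev IOType (A : VOA) (W1 W2 W3 : VModule A) := W1.W → ℝ → W2.W → W3.W

/-- The defining properties of an intertwining operator of type `(W₃; W₁ W₂)`:
bilinearity, lower truncation, the `L(-1)`-derivative property, and the (Borcherds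
form of the) Jacobi identity. -/
def IsIntw (A : VOA) (W1 W2 W3 : VModule A) (f : IOType A W1 W2 W3) : Prop :=
  (∀ (x y : W1.W) (n : ℝ) (w : W2.W), f (x + y) n w = f x n w + f y n w) ∧
  (∀ (c : ℂ) (x : W1.W) (n : ℝ) (w : W2.W), f (c • x) n w = c • f x n w) ∧
  (∀ (x : W1.W) (n : ℝ) (w w' : W2.W), f x n (w + w') = f x n w + f x n w') ∧
  (∀ (c : ℂ) (x : W1.W) (n : ℝ) (w : W2.W), f x n (c • w) = c • f x n w) ∧
  (∀ (x : W1.W) (w : W2.W), ∃ N : ℝ, ∀ n ≥ N, f x n w = 0) ∧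
  (∀ (x : W1.W) (n : ℝ) (w : W2.W),
    f (W1.act A.ω 0 x) n w = (-(n : ℂ)) • f x (n - 1) w) ∧
  (∀ (u : A.V) (x : W1.W) (w : W2.W) (p r : ℤ) (q : ℝ),
    (∑ᶠ i : ℕ, cchoose (p : ℂ) i • f (W1.act u (r + i) x) ((p : ℝ) + q - (i : ℝ)) w)
      = ∑ᶠ i : ℕ, ((-1 : ℂ) ^ i * cchoose (r : ℂ) i) •
          (W3.act u (p + r - i) (f x (q + (i : ℝ)) w)
            - (-1 : ℂ) ^ r • f x (q + (r : ℝ) - (i : ℝ)) (W2.act u (p + i) w)))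

/-- The set of intertwining operators of type `(W₃; W₁ W₂)`. -/
def IntwSet (A : VOA) (W1 W2 W3 : VModule A) : Set (IOType A W1 W2 W3) :=
  {f | IsIntw A W1 W2 W3 f}

/-- The space of intertwining operators of type `(W₃; W₁ W₂)`. -/
def IntwSpace (A : VOA) (W1 W2 W3 : VModule A) : Submodule ℂ (IOType A W1 W2 W3) :=
  Submodule.span ℂ (IntwSet A W1 W2 W3)

/-- The fusion rule `N_{W₁ W₂}^{W₃}`. -/
def fusionRule (A : VOA) (W1 W2 W3 : VModule A) : ℕ :=
  Module.finrank ℂ (IntwSpace A W1 W2 W3)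

/-- The action `σ₁₂` (skew symmetry) on intertwining operators:
`σ₁₂(𝒴)(w₂, x)w₁ = e^{x L(-1)} 𝒴(w₁, e^{πi} x) w₂`, in mode form. -/
def sigma12 (A : VOA) (W1 W2 W3 : VModule A) (f : IOType A W1 W2 W3) :
    IOType A W2 W1 W3 :=
  fun w2 n w1 =>
    ∑ᶠ j : ℕ, (((j.factorial : ℂ))⁻¹ *
        Complex.exp ((Real.pi : ℂ) * Complex.I * (-(n + j) - 1))) •
      ((W3.act A.ω 0) ^ j) (f w1 (n + j) w2)

/-! ## The setup of irreducible modules, contragredient pairings and `S₃`-action -/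

/-- The data of the (finite) collection `𝒜` of equivalence classes of irreducible
`V`-modules, with chosen representatives, contragredient involution and pairings,
lowest weights, and the action `σ₂₃`. -/
structure IrrSetup (A : VOA) where
  𝒜 : Type
  [fin : Fintype 𝒜]
  [deceq : DecidableEq 𝒜]
  Wm : 𝒜 → VModule A
  e : 𝒜
  dual : 𝒜 → 𝒜
  dual_invol : ∀ a, dual (dual a) = a
  dual_e : dual e = e
  irr : ∀ a, (Wm a).IsIrred
  complete : ∀ M : VModule A, M.IsIrred → ∃ a, M.Iso (Wm a)
  distinct : ∀ a b, (Wm a).Iso (Wm b) → a = b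
  eqV : (Wm e).W ≃ₗ[ℂ] A.V
  eqV_act : ∀ u n x, eqV ((Wm e).act u n x) = A.Yop u n (eqV x)
  hwt : 𝒜 → ℝ
  hwt_support : ∀ a (r : ℝ), (Wm a).P r ≠ 0 → ∃ k : ℕ, r = hwt a + k
  pairW : ∀ a, (Wm (dual a)).W → (Wm a).W → ℂ
  pairW_bilin : ∀ a, IsBilinMap (pairW a)
  pairW_nondegl : ∀ a x, (∀ y, pairW a x y = 0) → x = 0
  pairW_nondegr : ∀ a y, (∀ x, pairW a x y = 0) → y = 0
  pairW_graded : ∀ a (r s : ℝ) x y, r ≠ s →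
    pairW a ((Wm (dual a)).P r x) ((Wm a).P s y) = 0
  pairW_adj : ∀ a (mw : ℤ) (u : A.V), A.P mw u = u → ∀ (n : ℤ) x y,
    pairW a ((Wm (dual a)).act u n x) y
      = ∑ᶠ j : ℕ, (((-1 : ℂ) ^ mw) / (j.factorial : ℂ)) *
          pairW a x ((Wm a).act (((A.Yop A.ω 2) ^ j) u) (2 * mw - n - 2 - j) y)
  s23 : ∀ a1 a2 a3, IOType A (Wm a1) (Wm a2) (Wm a3) →
    IOType A (Wm a1) (Wm (dual a3)) (Wm (dual a2))
  s23_intw : ∀ a1 a2 a3 f, IsIntw A (Wm a1) (Wm a2) (Wm a3) f →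
    IsIntw A (Wm a1) (Wm (dual a3)) (Wm (dual a2)) (s23 a1 a2 a3 f)
  s23_def : ∀ a1 a2 a3 (f : IOType A (Wm a1) (Wm a2) (Wm a3)) (h : ℝ) (w1 : (Wm a1).W),
    (Wm a1).P h w1 = w1 →
    ∀ (n : ℝ) (w3' : (Wm (dual a3)).W) (w2 : (Wm a2).W),
      pairW a2 (s23 a1 a2 a3 f w1 n w3') w2
        = Complex.exp ((Real.pi : ℂ) * Complex.I * ((hwt a1 : ℂ) - (h : ℂ))) *
            ∑ᶠ j : ℕ, ((j.factorial : ℂ))⁻¹ *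
              pairW a3 w3' (f ((((Wm a1).act A.ω 2) ^ j) w1)
                (2 * h - n - 2 - j) w2)

attribute [instance] IrrSetup.fin IrrSetup.deceq

namespace IrrSetup

variable {A : VOA} (S : IrrSetup A)

/-- Transport of vectors along an equality of labels. -/
def vcast {a b : S.𝒜} (h : a = b) (x : (S.Wm a).W) : (S.Wm b).W :=
  cast (congrArg (fun c => (S.Wm c).W) h) x

/-- Transport of candidate intertwining operators along equalities of labels. -/
def icast {a1 b1 a2 b2 a3 b3 : S.𝒜} (h1 : a1 = b1) (h2 : a2 = b2) (h3 : a3 = b3)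
    (f : IOType A (S.Wm a1) (S.Wm a2) (S.Wm a3)) :
    IOType A (S.Wm b1) (S.Wm b2) (S.Wm b3) :=
  fun w1 n w2 => S.vcast h3 (f (S.vcast h1.symm w1) n (S.vcast h2.symm w2))

/-- The canonical intertwining operator `𝒴_{ea;1}^a`, the vertex operator defining the
module structure on `W^a`. -/
def Yea (a : S.𝒜) : IOType A (S.Wm S.e) (S.Wm a) (S.Wm a) :=
  fun v n w => by
    classical exact
      if h : ∃ m : ℤ, (m : ℝ) = n then (S.Wm a).act (S.eqV v) h.choose w else 0

/-- The canonical intertwining operator `𝒴_{ae;1}^a = σ₁₂(𝒴_{ea;1}^a)`. -/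
def Yae (a : S.𝒜) : IOType A (S.Wm a) (S.Wm S.e) (S.Wm a) :=
  sigma12 A (S.Wm S.e) (S.Wm a) (S.Wm a) (S.Yea a)

/-- The canonical intertwining operator `𝒴_{aa';1}^e = σ₂₃(𝒴_{ae;1}^a)`. -/
def Yaad (a : S.𝒜) : IOType A (S.Wm a) (S.Wm (S.dual a)) (S.Wm S.e) :=
  S.icast rfl rfl S.dual_e (S.s23 a S.e a (S.Yae a))

/-- The matrix coefficient of the product
`⟨w₄', 𝒴₁(w₁, z₁) 𝒴₂(w₂, z₂) w₃⟩` at real points `z₁, z₂ > 0` (no branch ambiguity). -/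
def prodEval {a1 a2 a3 a4 a5 : S.𝒜}
    (f1 : IOType A (S.Wm a1) (S.Wm a5) (S.Wm a4))
    (f2 : IOType A (S.Wm a2) (S.Wm a3) (S.Wm a5)) (z1 z2 : ℝ)
    (w1 : (S.Wm a1).W) (w2 : (S.Wm a2).W) (w3 : (S.Wm a3).W)
    (w4' : (S.Wm (S.dual a4)).W) : ℂ :=
  ∑' mn : ℝ × ℝ,
    ((Real.rpow z1 (-mn.1 - 1) : ℝ) : ℂ) * ((Real.rpow z2 (-mn.2 - 1) : ℝ) : ℂ) *
      S.pairW a4 w4' (f1 w1 mn.1 (f2 w2 mn.2 w3))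

/-- The matrix coefficient of the iterate
`⟨w₄', 𝒴₃(𝒴₄(w₁, z₀) w₂, z₂) w₃⟩` at real points `z₀, z₂ > 0`. -/
def iterEval {a1 a2 a3 a4 a6 : S.𝒜}
    (f3 : IOType A (S.Wm a6) (S.Wm a3) (S.Wm a4))
    (f4 : IOType A (S.Wm a1) (S.Wm a2) (S.Wm a6)) (z0 z2 : ℝ)
    (w1 : (S.Wm a1).W) (w2 : (S.Wm a2).W) (w3 : (S.Wm a3).W)
    (w4' : (S.Wm (S.dual a4)).W) : ℂ :=
  ∑' mn : ℝ × ℝ,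
    ((Real.rpow z0 (-mn.1 - 1) : ℝ) : ℂ) * ((Real.rpow z2 (-mn.2 - 1) : ℝ) : ℂ) *
      S.pairW a4 w4' (f3 (f4 w1 mn.1 w2) mn.2 w3)

/-- The series
`⟨e^{L(1)} 𝒴₂((1-z₁-z₂)^{L(0)} w̃'₁, z₁) w̃'₂, e^{L(1)} 𝒴₁((1-z₁-z₂)^{L(0)} w̃₁, z₂) w̃₂⟩`
of Proposition 3.2 of Huang–Kong, evaluated on the real slice `x = 1 - z₁ - z₂ > 0`,
`z₂ > 0` (so `z₁ = 1 - z₂ - x`). -/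
def resExpr {a1 a2 a3 : S.𝒜}
    (Y1 : IOType A (S.Wm a1) (S.Wm a2) (S.Wm a3))
    (Y2 : IOType A (S.Wm (S.dual a1)) (S.Wm (S.dual a2)) (S.Wm (S.dual a3)))
    (x z2 : ℝ) (w1 : (S.Wm a1).W) (w2 : (S.Wm a2).W)
    (w1' : (S.Wm (S.dual a1)).W) (w2' : (S.Wm (S.dual a2)).W) : ℂ :=
  ∑' q : (ℝ × ℝ) × ℕ × ℕ,
    (((Real.rpow (1 - z2 - x) (-q.1.1 - 1) * Real.rpow z2 (-q.1.2 - 1)) : ℝ) : ℂ) /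
        ((q.2.1.factorial : ℂ) * (q.2.2.factorial : ℂ)) *
      S.pairW a3
        ((((S.Wm (S.dual a3)).act A.ω 2) ^ q.2.1)
          (Y2 ((S.Wm (S.dual a1)).rL0 x ((S.Wm (S.dual a1)).expL1neg w1')) q.1.1
            ((S.Wm (S.dual a2)).expL1neg w2')))
        ((((S.Wm a3).act A.ω 2) ^ q.2.2)
          (Y1 ((S.Wm a1).rL0 x ((S.Wm a1).expL1neg w1)) q.1.2
            ((S.Wm a2).expL1neg w2)))

/-- `pr` is the family of pairings `⟨·,·⟩_{𝒱_{a₁a₂}^{a₃}}` defined by the residue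
formula (2.? / (3.3)) of Huang–Kong: the expression `resExpr`, as a function of
`x = 1 - z₁ - z₂`, expands in real powers of `x`, and the coefficient of `x⁰`
(= the residue of `x⁻¹` times the expression) equals
`⟨w'₁, w₁⟩ ⟨w'₂, w₂⟩ ⟨𝒴₁, 𝒴₂⟩`. -/
def IsVPairing
    (pr : ∀ a1 a2 a3 : S.𝒜, IOType A (S.Wm a1) (S.Wm a2) (S.Wm a3) →
      IOType A (S.Wm (S.dual a1)) (S.Wm (S.dual a2)) (S.Wm (S.dual a3)) → ℂ) : Prop :=
  ∀ (a1 a2 a3 : S.𝒜) (Y1 : IOType A (S.Wm a1) (S.Wm a2) (S.Wm a3))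
    (Y2 : IOType A (S.Wm (S.dual a1)) (S.Wm (S.dual a2)) (S.Wm (S.dual a3))),
    Y1 ∈ IntwSet A (S.Wm a1) (S.Wm a2) (S.Wm a3) →
    Y2 ∈ IntwSet A (S.Wm (S.dual a1)) (S.Wm (S.dual a2)) (S.Wm (S.dual a3)) →
    ∀ w1 w2 w1' w2', ∃ c : ℝ → ℝ → ℂ,
      (∀ x z2 : ℝ, 0 < x → x < z2 → x + z2 < 1 →
        Summable (fun n : ℝ => ‖c n z2 * ((Real.rpow x n : ℝ) : ℂ)‖) ∧
        S.resExpr Y1 Y2 x z2 w1 w2 w1' w2'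
          = ∑' n : ℝ, c n z2 * ((Real.rpow x n : ℝ) : ℂ)) ∧
      (∀ z2 : ℝ, 0 < z2 → z2 < 1 →
        c 0 z2 = S.pairW a1 w1' w1 * S.pairW a2 w2' w2 * pr a1 a2 a3 Y1 Y2)

end IrrSetup
/-! ## Tensor product vertex operator algebras -/

/-- A vertex operator algebra realizing the tensor product `V^L ⊗ V^R`: a VOA `T`
together with a linear equivalence from `V^L ⊗ V^R` identifying vacua, conformal
elements, gradings and vertex operators. -/
structure TensorVOA (A B : VOA) where
  T : VOA
  ψ : TensorProduct ℂ A.V B.V ≃ₗ[ℂ] T.V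
  ψ_one : ψ (A.one ⊗ₜ[ℂ] B.one) = T.one
  ψ_ω : ψ (A.ω ⊗ₜ[ℂ] B.one + A.one ⊗ₜ[ℂ] B.ω) = T.ω
  ψ_P : ∀ (p q : ℤ) (u : A.V) (v : B.V) (n : ℤ),
    T.P n (ψ (A.P p u ⊗ₜ[ℂ] B.P q v))
      = if n = p + q then ψ (A.P p u ⊗ₜ[ℂ] B.P q v) else 0
  ψ_Y : ∀ (u : A.V) (v : B.V) (w : A.V) (w' : B.V) (n : ℤ),
    T.Yop (ψ (u ⊗ₜ[ℂ] v)) n (ψ (w ⊗ₜ[ℂ] w'))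
      = ψ (∑ᶠ i : ℤ, A.Yop u i w ⊗ₜ[ℂ] B.Yop v (n - 1 - i) w')

/-! ## Full field algebras over `V^L ⊗ V^R` -/

/-- A (conformal) full field algebra over `V^L ⊗ V^R`: a grading-restricted ℝ×ℝ-graded
full field algebra equipped with an injective homomorphism `ρ` from the full field
algebra `V^L ⊗ V^R`, such that `𝔡^L = L^L(0)`, `𝔡^R = L^R(0)`, `D^L = L^L(-1)` and
`D^R = L^R(-1)`, where `L^{L}(n)` (resp. `L^R(n)`) are the modes of the formal full
vertex operator of `ρ(ω^L ⊗ 𝟏^R)` (resp. `ρ(𝟏^L ⊗ ω^R)`). -/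
structure FFAover (A B : VOA) extends RxRFFA where
  grading_res : toRxRFFA.GradingRestricted
  ρ : TensorProduct ℂ A.V B.V →ₗ[ℂ] g.F
  ρ_inj : Function.Injective ρ
  ρ_vac : ρ (A.one ⊗ₜ[ℂ] B.one) = vac
  ρ_grading : ∀ (p q : ℤ) (u : A.V) (v : B.V) (p' q' : ℝ),
    PLR p' q' (ρ (A.P p u ⊗ₜ[ℂ] B.P q v))
      = if p' = (p : ℝ) ∧ q' = (q : ℝ) then ρ (A.P p u ⊗ₜ[ℂ] B.P q v) else 0
  ρ_Y : ∀ (u : A.V) (v : B.V) (w : A.V) (w' : B.V) (z : ℂ), z ≠ 0 → ∀ r : ℝ,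
    toFullFieldAlgebra.Y (ρ (u ⊗ₜ[ℂ] v)) z (ρ (w ⊗ₜ[ℂ] w')) r
      = ρ (∑ᶠ n : ℤ, ∑ᶠ m : ℤ, ∑ᶠ p : ℤ, ∑ᶠ q : ℤ,
          (if ((p : ℝ) + (q : ℝ) = r) then (1 : ℂ) else 0) •
            (z ^ (-n - 1) * (starRingEnd ℂ z) ^ (-m - 1)) •
              (A.P p (A.Yop u n w) ⊗ₜ[ℂ] B.P q (B.Yop v m w')))
  dL_L0 : ∀ x, dLop x = toRxRFFA.Ymode (ρ (A.ω ⊗ₜ[ℂ] B.one)) 1 (-1) x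
  dR_L0 : ∀ x, dRop x = toRxRFFA.Ymode (ρ (A.one ⊗ₜ[ℂ] B.ω)) (-1) 1 x
  DL_L1 : ∀ x, DL x = toRxRFFA.Ymode (ρ (A.ω ⊗ₜ[ℂ] B.one)) 0 (-1) x
  DR_L1 : ∀ x, DR x = toRxRFFA.Ymode (ρ (A.one ⊗ₜ[ℂ] B.ω)) (-1) 0 x

namespace FFAover

variable {A B : VOA} (Φ : FFAover A B)

/-- The Virasoro operators `L^L(n)` of a full field algebra over `V^L ⊗ V^R`. -/
def LL (n : ℤ) (x : Φ.g.F) : Φ.g.F :=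
  Φ.Ymode (Φ.ρ (A.ω ⊗ₜ[ℂ] B.one)) ((n : ℝ) + 1) (-1) x

/-- The Virasoro operators `L^R(n)` of a full field algebra over `V^L ⊗ V^R`. -/
def LR (n : ℤ) (x : Φ.g.F) : Φ.g.F :=
  Φ.Ymode (Φ.ρ (A.one ⊗ₜ[ℂ] B.ω)) (-1) ((n : ℝ) + 1) x

end FFAover

/-! ## Bigradings and analytic splittings on modules for `V^L ⊗ V^R` -/

/-- The bidegree-`(l, r)` mode `𝕐_{l,r}` of an intertwining operator `f` of type
`(F; F F)` on a bigraded module, extracted from the mode `l + r + 1` by bigraded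
components. -/
def bimode {A : VOA} (M : VModule A) (Q : ℝ → ℝ → Module.End ℂ M.W)
    (f : IOType A M M M) (u : M.W) (l r : ℝ) (v : M.W) : M.W :=
  ∑ᶠ a : ℝ, ∑ᶠ b : ℝ, ∑ᶠ c : ℝ, ∑ᶠ d : ℝ,
    Q (a + c - l - 1) (b + d - r - 1) (f (Q a b u) (l + r + 1) (Q c d v))

/-- `Q` is the bigrading of a module for `V^L ⊗ V^R` by the eigenvalues of
`L^L(0)` and `L^R(0)`. -/
def GoodBigrading {A B : VOA} (T : TensorVOA A B) (M : VModule T.T)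
    (Q : ℝ → ℝ → Module.End ℂ M.W) : Prop :=
  (∀ p q p' q' x, Q p q (Q p' q' x) = if p = p' ∧ q = q' then Q p' q' x else 0) ∧
  (∀ x : M.W, {pq : ℝ × ℝ | Q pq.1 pq.2 x ≠ 0}.Finite) ∧
  (∀ (r : ℝ) (x : M.W), M.P r x = ∑ᶠ p : ℝ, Q p (r - p) x) ∧
  (∀ (p q : ℝ) (x : M.W),
    M.act (T.ψ (A.ω ⊗ₜ[ℂ] B.one)) 1 (Q p q x) = (p : ℂ) • Q p q x) ∧
  (∀ (p q : ℝ) (x : M.W),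
    M.act (T.ψ (A.one ⊗ₜ[ℂ] B.ω)) 1 (Q p q x) = (q : ℂ) • Q p q x)

/-- A term of the expansion of `⟨w', 𝕐_an(u; z₁, ζ₁) 𝕐_an(v; z₂, ζ₂) w⟩` for the
analytic splitting of an intertwining operator on a bigraded module. -/
def anProdTerm {A : VOA} (M : VModule A) (Q : ℝ → ℝ → Module.End ℂ M.W)
    (f : IOType A M M M) (w' : M.Dual) (u v w : M.W) (z1 ζ1 z2 ζ2 : ℂ)
    (p : (ℝ × ℝ) × ℝ × ℝ) : ℂ :=
  cpowNN z1 (-(p.1.1 : ℂ) - 1) * cpowNNbar ζ1 (-(p.1.2 : ℂ) - 1) *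
  cpowNN z2 (-(p.2.1 : ℂ) - 1) * cpowNNbar ζ2 (-(p.2.2 : ℂ) - 1) *
  w'.1 (bimode M Q f u p.1.1 p.1.2 (bimode M Q f v p.2.1 p.2.2 w))

/-- A term of the expansion of `⟨w', 𝕐_an(𝕐_an(u; z₁-z₂, ζ₁-ζ₂)v; z₂, ζ₂) w⟩`. -/
def anIterTerm {A : VOA} (M : VModule A) (Q : ℝ → ℝ → Module.End ℂ M.W)
    (f : IOType A M M M) (w' : M.Dual) (u v w : M.W) (z1 ζ1 z2 ζ2 : ℂ)
    (p : (ℝ × ℝ) × ℝ × ℝ) : ℂ :=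
  cpowNN (z1 - z2) (-(p.1.1 : ℂ) - 1) * cpowNNbar (ζ1 - ζ2) (-(p.1.2 : ℂ) - 1) *
  cpowNN z2 (-(p.2.1 : ℂ) - 1) * cpowNNbar ζ2 (-(p.2.2 : ℂ) - 1) *
  w'.1 (bimode M Q f (bimode M Q f u p.1.1 p.1.2 v) p.2.1 p.2.2 w)

/-- The five conditions of Theorem 2.? (`r-conf-alg-2-prop`) of Huang–Kong on a module
`F` for `V^L ⊗ V^R`, an intertwining operator `𝒴` of type `(F; F F)` and an injective
linear map `ρ : V^L ⊗ V^R → F`: the identity property, the creation property,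
associativity of the analytic splitting, single-valuedness, and skew symmetry. -/
def FiveConds {A B : VOA} (T : TensorVOA A B) (M : VModule T.T)
    (Q : ℝ → ℝ → Module.End ℂ M.W) (f : IOType T.T M M M)
    (ρ₀ : TensorProduct ℂ A.V B.V →ₗ[ℂ] M.W) : Prop :=
  -- (1) identity property
  (∀ (n : ℝ) (w : M.W),
    f (ρ₀ (A.one ⊗ₜ[ℂ] B.one)) n w = if n = -1 then w else 0) ∧
  -- (2) creation property
  (∀ u : M.W, f u (-1) (ρ₀ (A.one ⊗ₜ[ℂ] B.one)) = u ∧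
    ∀ n : ℝ, -1 < n → f u n (ρ₀ (A.one ⊗ₜ[ℂ] B.one)) = 0) ∧
  -- (3) associativity of the analytic splitting in |z₁|>|z₂|>0, |ζ₁|>|ζ₂|>0
  (∀ (u v w : M.W) (w' : M.Dual) (z1 ζ1 z2 ζ2 : ℂ),
    ‖z1‖ > ‖z2‖ → ‖z2‖ > 0 →
    ‖ζ1‖ > ‖ζ2‖ → ‖ζ2‖ > 0 →
      Summable (fun p : (ℝ × ℝ) × ℝ × ℝ =>
        ‖anProdTerm M Q f w' u v w z1 ζ1 z2 ζ2 p‖) ∧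
      Summable (fun p : (ℝ × ℝ) × ℝ × ℝ =>
        ‖anIterTerm M Q f w' u v w z1 ζ1 z2 ζ2 p‖) ∧
      (∑' p : (ℝ × ℝ) × ℝ × ℝ, anProdTerm M Q f w' u v w z1 ζ1 z2 ζ2 p)
        = ∑' p : (ℝ × ℝ) × ℝ × ℝ, anIterTerm M Q f w' u v w z1 ζ1 z2 ζ2 p) ∧
  -- (4) single-valuedness
  (∀ (p q : ℝ) (x : M.W),
    Complex.exp (((2 * Real.pi : ℝ) : ℂ) * Complex.I * ((p : ℂ) - (q : ℂ))) • Q p q x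
      = Q p q x) ∧
  -- (5) skew symmetry: 𝕐^𝒴(u; 1, 1)v = e^{L^L(-1)+L^R(-1)} 𝕐^𝒴(v; e^{πi}, e^{-πi})u
  (∀ (u v : M.W) (w' : M.Dual),
    Summable (fun n : ℝ => ‖w'.1 (f u n v)‖) ∧
    Summable (fun q : (ℝ × ℝ) × ℕ × ℕ =>
      ‖(Complex.exp ((Real.pi : ℂ) * Complex.I * (-(q.1.1 : ℂ) - 1)) *
          Complex.exp (-(Real.pi : ℂ) * Complex.I * (-(q.1.2 : ℂ) - 1)) /
          ((q.2.1.factorial : ℂ) * (q.2.2.factorial : ℂ))) *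
        w'.1 ((M.act (T.ψ (A.ω ⊗ₜ[ℂ] B.one)) 0 ^ q.2.1)
          ((M.act (T.ψ (A.one ⊗ₜ[ℂ] B.ω)) 0 ^ q.2.2)
            (bimode M Q f v q.1.1 q.1.2 u)))‖) ∧
    (∑' n : ℝ, w'.1 (f u n v))
      = ∑' q : (ℝ × ℝ) × ℕ × ℕ,
          (Complex.exp ((Real.pi : ℂ) * Complex.I * (-(q.1.1 : ℂ) - 1)) *
            Complex.exp (-(Real.pi : ℂ) * Complex.I * (-(q.1.2 : ℂ) - 1)) /
            ((q.2.1.factorial : ℂ) * (q.2.2.factorial : ℂ))) *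
          w'.1 ((M.act (T.ψ (A.ω ⊗ₜ[ℂ] B.one)) 0 ^ q.2.1)
            ((M.act (T.ψ (A.one ⊗ₜ[ℂ] B.ω)) 0 ^ q.2.2)
              (bimode M Q f v q.1.1 q.1.2 u))))

/-! ## Laurent series -/

/-- Coefficient extraction for a Laurent series converging on a circle. -/
lemma circleIntegral_of_hasSum_zpow {a : ℤ → ℂ} {G : ℂ → ℂ} {R : ℝ} (hR : 0 < R)
    (h : ∀ z : ℂ, ‖z‖ = R → HasSum (fun n : ℤ => a n * z ^ (-n - 2)) (G z)) (m : ℤ) :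
    (∮ z in C(0, R), z ^ (m + 1) * G z) = 2 * Real.pi * I * a m := by
  have hsum : Summable fun n : ℤ => ‖a n‖ * R ^ (-n - 2) := by
    have := (h (R : ℂ) (by simp [abs_of_pos hR])).summable.norm
    simpa [abs_of_pos hR] using this
  have hc : ∀ θ : ℝ, ‖circleMap 0 R θ‖ = R := fun θ => by simp [abs_of_pos hR]
  have key : HasSum (fun n : ℤ => ∮ z in C(0, R), z ^ (m + 1) * (a n * z ^ (-n - 2)))
      (∮ z in C(0, R), z ^ (m + 1) * G z) := by
    unfold circleIntegral
    refine intervalIntegral.hasSum_integral_of_dominated_convergence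
      (fun n _ => R * R ^ (m + 1) * (‖a n‖ * R ^ (-n - 2))) ?_ ?_ ?_ ?_ ?_
    · intro n
      refine Continuous.aestronglyMeasurable ?_
      have h0 : ∀ θ : ℝ, circleMap 0 R θ ≠ 0 := fun θ => by simp [hR.ne']
      have hk : ∀ k : ℤ, Continuous fun θ : ℝ => circleMap 0 R θ ^ k := fun k =>
        (continuous_circleMap 0 R).zpow₀ k (fun θ => Or.inl (h0 θ))
      simp only [deriv_circleMap, smul_eq_mul]
      exact ((continuous_circleMap 0 R).mul continuous_const).mul
        ((hk _).mul (continuous_const.mul (hk _)))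
    · intro n
      refine Filter.Eventually.of_forall fun θ _ => ?_
      simp only [deriv_circleMap, smul_eq_mul, norm_mul, norm_zpow, hc, norm_I, mul_one]
      rw [mul_assoc]
    · exact Filter.Eventually.of_forall fun θ _ => hsum.mul_left _
    · simp
    · refine Filter.Eventually.of_forall fun θ _ => ?_
      simp only [smul_eq_mul]
      exact ((h _ (hc θ)).mul_left _).mul_left _
  have hterm : ∀ n : ℤ, (∮ z in C(0, R), z ^ (m + 1) * (a n * z ^ (-n - 2)))
      = if n = m then 2 * Real.pi * I * a m else 0 := by
    intro n
    have : (∮ z in C(0, R), z ^ (m + 1) * (a n * z ^ (-n - 2)))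
        = ∮ z in C(0, R), a n * (z - 0) ^ (m - n - 1) := by
      refine circleIntegral.integral_congr hR.le fun z hz => ?_
      have hz0 : z ≠ 0 := by
        rintro rfl
        simp at hz
        exact hR.ne hz
      simp only [sub_zero]
      rw [mul_left_comm, ← zpow_add₀ hz0]
      congr 2
      ring
    rw [this, circleIntegral.integral_const_mul]
    split_ifs with hnm
    · subst hnm
      have : (∮ z in C(0, R), (z - 0) ^ (n - n - 1)) = ∮ z in C(0, R), (z - (0 : ℂ))⁻¹ := by
        simp
      rw [this, circleIntegral.integral_sub_inv_of_mem_ball (by simpa using hR)]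
      ring
    · rw [circleIntegral.integral_sub_zpow_of_ne (by omega), mul_zero]
  simp only [hterm] at key
  exact key.unique (hasSum_ite_eq m _)

/-- A Laurent series which converges on an open annulus defines a holomorphic function there. -/
lemma differentiableAt_of_hasSum_zpow {a : ℤ → ℂ} {G : ℂ → ℂ} {r R : ℝ} (hr : 0 < r)
    (h : ∀ z : ℂ, r ≤ ‖z‖ → ‖z‖ ≤ R → HasSum (fun n : ℤ => a n * z ^ (-n - 2)) (G z))
    {z : ℂ} (hz : r < ‖z‖) (hz' : ‖z‖ < R) : DifferentiableAt ℂ G z := by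
  have hR : 0 < R := hr.trans (hz.trans hz')
  have hsum : ∀ ρ : ℝ, r ≤ ρ → ρ ≤ R → Summable fun n : ℤ => ‖a n‖ * ρ ^ (-n - 2) := by
    intro ρ h1 h2
    have h0 : |ρ| = ρ := abs_of_pos (hr.trans_le h1)
    have := (h (ρ : ℂ) (by simpa [h0]) (by simpa [h0])).summable.norm
    simpa [h0] using this
  set U : Set ℂ := {w | r < ‖w‖ ∧ ‖w‖ < R} with hU
  have hUo : IsOpen U :=
    (isOpen_lt continuous_const continuous_norm).inter (isOpen_lt continuous_norm continuous_const)
  have hd : DifferentiableOn ℂ (fun w => ∑' n : ℤ, a n * w ^ (-n - 2)) U := by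
    refine Complex.differentiableOn_tsum_of_summable_norm
      ((hsum r le_rfl (hz.trans hz').le).add (hsum R (hz.trans hz').le le_rfl)) ?_ hUo ?_
    · intro n w hw
      have : w ≠ 0 := norm_pos_iff.1 (hr.trans hw.1)
      exact ((differentiableAt_zpow.2 (Or.inl this)).const_mul _).differentiableWithinAt
    · intro n w hw
      have hw0 : 0 < ‖w‖ := hr.trans hw.1
      rw [norm_mul, norm_zpow, ← mul_add]
      refine mul_le_mul_of_nonneg_left ?_ (norm_nonneg _)
      rcases le_total 0 (-n - 2) with hk | hk
      · have := zpow_le_zpow_left₀ hk hw0.le hw.2.le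
        have h2 : 0 ≤ r ^ (-n - 2) := (zpow_pos hr _).le
        linarith
      · have := zpow_le_zpow_left₀ (n := -(-n - 2)) (by omega) hr.le hw.1.le
        rw [zpow_neg, zpow_neg] at this
        have := (inv_le_inv₀ (zpow_pos hr _) (zpow_pos hw0 _)).1 this
        have h2 : 0 ≤ R ^ (-n - 2) := (zpow_pos hR _).le
        linarith
  refine (((hd z ⟨hz, hz'⟩).differentiableAt (hUo.mem_nhds ⟨hz, hz'⟩))).congr_of_eventuallyEq ?_
  filter_upwards [hUo.mem_nhds (show z ∈ U from ⟨hz, hz'⟩)] with w hw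
  exact (h w hw.1.le hw.2.le).tsum_eq.symm

/-! ## Binomial coefficients with complex upper argument -/

lemma cchoose_succ (a : ℂ) (i : ℕ) :
    cchoose a (i + 1) = cchoose a i * (a - i) / (i + 1) := by
  rw [cchoose, cchoose, Finset.prod_range_succ, Nat.factorial_succ]
  push_cast
  have h1 : (i.factorial : ℂ) ≠ 0 := by exact_mod_cast i.factorial_ne_zero
  have h2 : (i : ℂ) + 1 ≠ 0 := by exact_mod_cast i.succ_ne_zero
  field_simp

lemma cchoose_natCast (M i : ℕ) : cchoose (M : ℂ) i = (M.choose i : ℂ) := by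
  induction i with
  | zero => simp [cchoose]
  | succ i ih =>
    have h2 : (i : ℂ) + 1 ≠ 0 := by exact_mod_cast i.succ_ne_zero
    rw [cchoose_succ, ih, div_eq_iff h2]
    rcases le_or_gt i M with h | h
    · rw [← Nat.cast_sub h]
      exact_mod_cast (Nat.choose_succ_right_eq M i).symm
    · rw [Nat.choose_eq_zero_of_lt h, Nat.choose_eq_zero_of_lt (h.trans i.lt_succ_self)]
      simp

lemma cchoose_neg (k i : ℕ) :
    cchoose (-(k : ℂ) - 1) i = (-1) ^ i * ((k + i).choose i : ℂ) := by
  induction i with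
  | zero => simp [cchoose]
  | succ i ih =>
    have h2 : (i : ℂ) + 1 ≠ 0 := by exact_mod_cast i.succ_ne_zero
    have h3 : ((k + i + 1 : ℕ) : ℂ) * ((k + i).choose i : ℂ)
        = ((k + i + 1).choose (i + 1) : ℂ) * ((i + 1 : ℕ) : ℂ) := by
      exact_mod_cast Nat.add_one_mul_choose_eq (k + i) i
    push_cast at h3
    rw [cchoose_succ, ih, div_eq_iff h2, ← add_assoc k i 1, mul_assoc ((-1) ^ (i + 1)), ← h3]
    ring

lemma hasSum_sub_one_zpow_of_one_lt {z : ℂ} (hz : 1 < ‖z‖) (i : ℕ) :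
    HasSum (fun n : ℤ => (if 0 ≤ n + 1 then ((n + 1).toNat.choose i : ℂ) else 0) * z ^ (-n - 2))
      ((z - 1) ^ (-(i : ℤ) - 1)) := by
  have hz0 : z ≠ 0 := by rintro rfl; simp at hz; linarith
  have hinv : ‖z⁻¹‖ < 1 := by rw [norm_inv]; exact inv_lt_one_of_one_lt₀ hz
  have h1 := (hasSum_choose_mul_geometric_of_norm_lt_one i hinv).mul_left (z ^ (-(i : ℤ) - 1))
  have hinj : Function.Injective fun j : ℕ => (j : ℤ) + i - 1 := fun a b hab => by
    simp only at hab; omega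
  rw [← hinj.hasSum_iff]
  · convert h1 using 1
    · rfl
    · funext j
      simp only [Function.comp]
      rw [if_pos (by omega), show ((j : ℤ) + i - 1 + 1).toNat = j + i by omega,
        show -((j : ℤ) + i - 1) - 2 = (-(i : ℤ) - 1) + (-(j : ℤ)) by ring, zpow_add₀ hz0,
        zpow_neg z (j : ℤ), zpow_natCast, inv_pow]
      ring
    · have : z - 1 = z * (1 - z⁻¹) := by field_simp
      rw [this, mul_zpow]
      congr 1
      rw [show -(i : ℤ) - 1 = -((i + 1 : ℕ) : ℤ) by push_cast; ring, zpow_neg, zpow_natCast,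
        one_div]
  · intro n hn
    split_ifs with h
    · rw [Nat.choose_eq_zero_of_lt]
      · simp
      · by_contra! hlt
        exact hn ⟨((n + 1) - i).toNat, by simp only; omega⟩
    · simp

lemma hasSum_sub_one_zpow_of_lt_one {z : ℂ} (hz : ‖z‖ < 1) (i : ℕ) :
    HasSum (fun n : ℤ => (if n ≤ -2 then (-1) ^ (i + 1) * (((-n - 2).toNat + i).choose i : ℂ)
      else 0) * z ^ (-n - 2)) ((z - 1) ^ (-(i : ℤ) - 1)) := by
  have h1 := (hasSum_choose_mul_geometric_of_norm_lt_one i hz).mul_left ((-1 : ℂ) ^ (i + 1))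
  have hinj : Function.Injective fun j : ℕ => -(j : ℤ) - 2 := fun a b hab => by
    simp only at hab; omega
  rw [← hinj.hasSum_iff]
  · convert h1 using 1
    · rfl
    · funext j
      simp only [Function.comp]
      rw [if_pos (by omega), show -(-(j : ℤ) - 2) - 2 = j by ring, Int.toNat_natCast, zpow_natCast]
      ring
    · rw [show -(i : ℤ) - 1 = -((i + 1 : ℕ) : ℤ) by push_cast; ring, zpow_neg, zpow_natCast,
        show z - 1 = (-1) * (1 - z) by ring, mul_pow, mul_inv, one_div, ← inv_pow (-1 : ℂ)]
      norm_num
  · intro n hn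
    rw [if_neg, zero_mul]
    intro h
    exact hn ⟨(-n - 2).toNat, by simp only; omega⟩

/-- The residue of `z ^ (m + 1) (z - 1) ^ (-i - 1)` at `1`, as a difference of integrals over
a large and a small circle around `0`. -/
lemma circleIntegral_sub_one_zpow (m : ℤ) (i : ℕ) :
    (∮ z in C(0, 2), z ^ (m + 1) * (z - 1) ^ (-(i : ℤ) - 1))
      - (∮ z in C(0, 1 / 2), z ^ (m + 1) * (z - 1) ^ (-(i : ℤ) - 1))
      = 2 * Real.pi * I * cchoose ((m : ℂ) + 1) i := by
  rw [circleIntegral_of_hasSum_zpow (by norm_num)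
      (fun z hz => hasSum_sub_one_zpow_of_one_lt (by rw [hz]; norm_num) i) m,
    circleIntegral_of_hasSum_zpow (by norm_num)
      (fun z hz => hasSum_sub_one_zpow_of_lt_one (by rw [hz]; norm_num) i) m,
    ← mul_sub]
  congr 1
  rcases le_or_gt 0 (m + 1) with hm | hm
  · obtain ⟨k, hk⟩ := Int.eq_ofNat_of_zero_le hm
    have : ((m : ℂ) + 1) = (k : ℂ) := by exact_mod_cast hk
    rw [if_pos hm, if_neg (by omega), this, cchoose_natCast, hk]
    simp
  · obtain ⟨k, hk⟩ := Int.eq_ofNat_of_zero_le (show 0 ≤ -m - 2 by omega)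
    have : ((m : ℂ) + 1) = -(k : ℂ) - 1 := by
      have : m = -k - 2 := by omega
      rw [this]; push_cast; ring
    rw [if_neg (by omega), if_pos (by omega), this, cchoose_neg, hk]
    simp [pow_succ]

/-- A function which is real continuously differentiable away from `0` and `1` and has Laurent
expansions around `0` inside and outside of the unit circle is holomorphic away from `0`, `1`. -/
lemma differentiableAt_of_hasSum_zpow_zero_infty {A B : ℤ → ℂ} {G : ℂ → ℂ}
    (hG : ContDiffOn ℝ 1 G {z | z ≠ 0 ∧ z ≠ 1})
    (hA : ∀ z : ℂ, 1 < ‖z‖ → HasSum (fun n : ℤ => A n * z ^ (-n - 2)) (G z))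
    (hB : ∀ z : ℂ, z ≠ 0 → ‖z‖ < 1 → HasSum (fun n : ℤ => B n * z ^ (-n - 2)) (G z))
    {z : ℂ} (hz0 : z ≠ 0) (hz1 : z ≠ 1) : DifferentiableAt ℂ G z := by
  have hout : ∀ w : ℂ, 1 < ‖w‖ → DifferentiableAt ℂ G w := fun w hw =>
    differentiableAt_of_hasSum_zpow (r := (1 + ‖w‖) / 2) (R := ‖w‖ + 1) (by positivity)
      (fun y hy _ => hA y (by linarith)) (by linarith) (by linarith)
  have hin : ∀ w : ℂ, w ≠ 0 → ‖w‖ < 1 → DifferentiableAt ℂ G w := fun w hw0 hw => by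
    have h0 : 0 < ‖w‖ := norm_pos_iff.2 hw0
    exact differentiableAt_of_hasSum_zpow (r := ‖w‖ / 2) (R := (‖w‖ + 1) / 2) (by positivity)
      (fun y hy hy' => hB y (norm_pos_iff.1 (by linarith)) (by linarith))
      (by linarith) (by linarith)
  rcases lt_trichotomy ‖z‖ 1 with h | h | h
  · exact hin z hz0 h
  · have hopen : IsOpen {z : ℂ | z ≠ 0 ∧ z ≠ 1} := isOpen_ne.inter isOpen_ne
    have hmem : z ∈ {z : ℂ | z ≠ 0 ∧ z ≠ 1} := ⟨hz0, hz1⟩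
    rw [differentiableAt_complex_iff_differentiableAt_real]
    refine ⟨(hG.differentiableOn (by norm_num) z hmem).differentiableAt (hopen.mem_nhds hmem), ?_⟩
    have hcont : ContinuousAt (fderiv ℝ G) z :=
      (hG.continuousOn_fderiv_of_isOpen hopen le_rfl).continuousAt (hopen.mem_nhds hmem)
    have hpath : Filter.Tendsto (fun t : ℝ => (t : ℂ) * z) (nhdsWithin 1 (Set.Ioi 1)) (nhds z) := by
      have : Continuous fun t : ℝ => (t : ℂ) * z := by fun_prop
      simpa using (this.tendsto 1).mono_left nhdsWithin_le_nhds
    have hI := (hcont.clm_apply (continuousAt_const (y := I))).tendsto.comp hpath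
    have h1 := ((hcont.clm_apply (continuousAt_const (y := (1 : ℂ)))).tendsto.comp hpath).const_smul I
    refine tendsto_nhds_unique (hI.congr' ?_) h1
    filter_upwards [self_mem_nhdsWithin] with t ht
    have ht' : 1 < ‖(t : ℂ) * z‖ := by
      rw [norm_mul, h, mul_one, Complex.norm_real]
      exact lt_of_lt_of_le ht (le_abs_self t)
    exact (differentiableAt_complex_iff_differentiableAt_real.1 (hout _ ht')).2
  · exact hout z h

lemma differentiableAt_sub_one_zpow (k : ℤ) {z : ℂ} (hz : z ≠ 1) :
    DifferentiableAt ℂ (fun w : ℂ => (w - 1) ^ k) z :=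
  (differentiableAt_id.sub_const (1 : ℂ)).zpow (Or.inl (sub_ne_zero.2 hz))

lemma ne_zero_and_ne_one_of_mem_sphere {R : ℝ} (hR : 0 < R) (hR1 : R ≠ 1) (z : ℂ)
    (hz : z ∈ Metric.sphere (0 : ℂ) R) : z ≠ 0 ∧ z ≠ 1 := by
  rw [mem_sphere_zero_iff_norm] at hz
  constructor
  · rintro rfl
    simp at hz
    exact hR.ne hz
  · rintro rfl
    simp at hz
    exact hR1 hz.symm

lemma circleIntegral_mul_sub_sum {G g : ℂ → ℂ} {c : ℕ → ℂ} (K : ℕ) {R : ℝ} (hR : 0 < R)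
    (hR1 : R ≠ 1) (k : ℤ) (hG : ContinuousOn G (Metric.sphere 0 R))
    (hg : ∀ z ∈ Metric.sphere (0 : ℂ) R,
      g z = G z - ∑ i ∈ Finset.range K, c i * (z - 1) ^ (-(i : ℤ) - 1)) :
    (∮ z in C(0, R), z ^ k * g z) = (∮ z in C(0, R), z ^ k * G z)
      - ∑ i ∈ Finset.range K, c i * ∮ z in C(0, R), z ^ k * (z - 1) ^ (-(i : ℤ) - 1) := by
  have hne := ne_zero_and_ne_one_of_mem_sphere hR hR1
  have hk : ContinuousOn (fun z : ℂ => z ^ k) (Metric.sphere 0 R) := fun z hz =>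
    (continuousAt_zpow₀ _ _ (Or.inl (hne z hz).1)).continuousWithinAt
  have hGi : CircleIntegrable (fun z => z ^ k * G z) 0 R :=
    (hk.mul hG).circleIntegrable hR.le
  have hPi : ∀ i ∈ Finset.range K, CircleIntegrable
      (fun z => c i * (z ^ k * (z - 1) ^ (-(i : ℤ) - 1))) 0 R := by
    intro i _
    refine ContinuousOn.circleIntegrable hR.le ?_
    refine continuousOn_const.mul (hk.mul fun z hz => ?_)
    exact (differentiableAt_sub_one_zpow _ (hne z hz).2).continuousAt.continuousWithinAt
  have hsum : (∑ i ∈ Finset.range K, c i * ∮ z in C(0, R), z ^ k * (z - 1) ^ (-(i : ℤ) - 1))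
      = ∮ z in C(0, R), ∑ i ∈ Finset.range K, c i * (z ^ k * (z - 1) ^ (-(i : ℤ) - 1)) := by
    rw [circleIntegral.integral_fun_sum hPi]
    exact Finset.sum_congr rfl fun i _ => (circleIntegral.integral_const_mul _ _ _ _).symm
  rw [hsum, ← circleIntegral.integral_sub hGi (CircleIntegrable.fun_sum _ hPi)]
  refine circleIntegral.integral_congr hR.le fun z hz => ?_
  rw [hg z hz, mul_sub, Finset.mul_sum]
  congr 1
  exact Finset.sum_congr rfl fun i _ => by ring

/-- Residue theorem relating the coefficients of the Laurent expansions of one function in the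
domains `|z| > 1`, `0 < |z| < 1` and `0 < |z - 1| < 1`. -/
lemma laurent_coeff_sub_eq {A B C : ℤ → ℂ} {G : ℂ → ℂ} (K : ℕ)
    (hG : ContDiffOn ℝ 1 G {z | z ≠ 0 ∧ z ≠ 1})
    (hA : ∀ z : ℂ, 1 < ‖z‖ → HasSum (fun n : ℤ => A n * z ^ (-n - 2)) (G z))
    (hB : ∀ z : ℂ, z ≠ 0 → ‖z‖ < 1 → HasSum (fun n : ℤ => B n * z ^ (-n - 2)) (G z))
    (hC : ∀ z : ℂ, z ≠ 1 → ‖z - 1‖ < 1 →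
      HasSum (fun n : ℤ => C n * (z - 1) ^ (-n - 2)) (G z))
    (hK : ∀ i : ℕ, K ≤ i → C ((i : ℤ) - 1) = 0) (m : ℤ) :
    A m - B m = ∑ i ∈ Finset.range K, cchoose ((m : ℂ) + 1) i * C ((i : ℤ) - 1) := by
  set P : ℂ → ℂ := fun z => ∑ i ∈ Finset.range K, C ((i : ℤ) - 1) * (z - 1) ^ (-(i : ℤ) - 1)
    with hP
  set g : ℂ → ℂ := fun z => if z = 1 then C (-2) else G z - P z with hg
  have hinj : Function.Injective fun j : ℕ => -(j : ℤ) - 2 := fun a b hab => by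
    simp only at hab; omega
  have hg1 : ∀ z : ℂ, ‖z - 1‖ < 1 → HasSum (fun j : ℕ => C (-(j : ℤ) - 2) * (z - 1) ^ j) (g z) := by
    intro z hz
    by_cases h1 : z = 1
    · subst h1
      have := hasSum_single (f := fun j : ℕ => C (-(j : ℤ) - 2) * ((1 : ℂ) - 1) ^ j) 0
        (fun j hj => by simp [hj])
      simpa [hg] using this
    · have hsub : HasSum (fun n : ℤ => if n ≤ -2 then 0 else C n * (z - 1) ^ (-n - 2)) (P z) := by
        have hinj' : Function.Injective fun j : ℕ => (j : ℤ) - 1 := fun a b hab => by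
          simp only at hab; omega
        rw [← hinj'.hasSum_iff]
        · have : HasSum (fun i : ℕ => C ((i : ℤ) - 1) * (z - 1) ^ (-(i : ℤ) - 1)) (P z) :=
            hasSum_sum_of_ne_finset_zero
              (fun i hi => by rw [hK i (by simpa using hi), zero_mul])
          convert this using 1
          funext i
          simp only [Function.comp]
          rw [if_neg (by omega)]
          congr 2
          ring
        · intro n hn
          rw [if_pos]
          by_contra! h
          exact hn ⟨(n + 1).toNat, by simp only; omega⟩
      have := (hC z h1 hz).sub hsub
      rw [← hinj.hasSum_iff] at this
      · simp only [hg, if_neg h1]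
        convert this using 1
        · rfl
        · funext j
          simp only [Function.comp]
          rw [if_pos (by omega), sub_zero, show -(-(j : ℤ) - 2) - 2 = j by ring, zpow_natCast]
      · intro n hn
        rw [if_neg, sub_self]
        intro h
        exact hn ⟨(-n - 2).toNat, by simp only; omega⟩
  have hgd : ∀ z : ℂ, z ≠ 0 → z ≠ 1 → DifferentiableAt ℂ g z := by
    intro z hz0 hz1
    have h1 : DifferentiableAt ℂ (fun z => G z - P z) z := by
      refine (differentiableAt_of_hasSum_zpow_zero_infty hG hA hB hz0 hz1).sub ?_
      refine DifferentiableAt.fun_sum fun i _ => ?_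
      exact (differentiableAt_sub_one_zpow _ hz1).const_mul _
    refine h1.congr_of_eventuallyEq ?_
    filter_upwards [isOpen_ne.mem_nhds hz1] with w hw
    simp only [hg]
    rw [if_neg hw]
  have hgc : ContinuousAt g 1 := by
    have hs : Summable fun j : ℕ => ‖C (-(j : ℤ) - 2)‖ * (1 / 2 : ℝ) ^ j := by
      have := (hg1 (1 + 1 / 2) (by norm_num)).summable.norm
      simpa using this
    have hc : ContinuousOn (fun z => ∑' j : ℕ, C (-(j : ℤ) - 2) * (z - 1) ^ j)
        (Metric.ball 1 (1 / 2)) := by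
      refine continuousOn_tsum (fun j => by fun_prop) hs fun j z hz => ?_
      rw [norm_mul, norm_pow]
      rw [mem_ball_iff_norm] at hz
      gcongr
    have hn : Metric.ball (1 : ℂ) (1 / 2) ∈ nhds 1 := Metric.ball_mem_nhds _ (by norm_num)
    refine (hc.continuousAt hn).congr ?_
    filter_upwards [hn] with z hz
    rw [mem_ball_iff_norm] at hz
    exact (hg1 z (by linarith)).tsum_eq
  have hgd' : ∀ z : ℂ, z ≠ 0 → z ≠ 1 → DifferentiableAt ℂ (fun z => z ^ (m + 1) * g z) z :=
    fun z h0 h1 => (differentiableAt_zpow.2 (Or.inl h0)).mul (hgd z h0 h1)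
  have hann : (∮ z in C(0, 2), z ^ (m + 1) * g z) = ∮ z in C(0, 1 / 2), z ^ (m + 1) * g z := by
    refine Complex.circleIntegral_eq_of_differentiable_on_annulus_off_countable (by norm_num)
      (by norm_num) (Set.countable_singleton (1 : ℂ)) ?_ ?_
    · intro z hz
      have hz0 : z ≠ 0 := by
        rintro rfl
        exact hz.2 (Metric.mem_ball_self (by norm_num))
      refine ContinuousAt.continuousWithinAt ?_
      by_cases h1 : z = 1
      · subst h1
        exact (continuousAt_zpow₀ _ _ (Or.inl one_ne_zero)).mul hgc
      · exact (hgd' z hz0 h1).continuousAt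
    · intro z hz
      refine hgd' z ?_ hz.2
      rintro rfl
      exact hz.1.2 (Metric.mem_closedBall_self (by norm_num))
  have hsplit : ∀ R : ℝ, 0 < R → R ≠ 1 → (∮ z in C(0, R), z ^ (m + 1) * g z)
      = (∮ z in C(0, R), z ^ (m + 1) * G z) - ∑ i ∈ Finset.range K,
        C ((i : ℤ) - 1) * ∮ z in C(0, R), z ^ (m + 1) * (z - 1) ^ (-(i : ℤ) - 1) := by
    intro R hR hR1
    have hne := ne_zero_and_ne_one_of_mem_sphere hR hR1
    refine circleIntegral_mul_sub_sum K hR hR1 _ (fun z hz => ?_) fun z hz => ?_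
    · exact (differentiableAt_of_hasSum_zpow_zero_infty hG hA hB (hne z hz).1
        (hne z hz).2).continuousAt.continuousWithinAt
    · simp only [hg, if_neg (hne z hz).2, hP]
  rw [hsplit 2 (by norm_num) (by norm_num), hsplit (1 / 2) (by norm_num) (by norm_num),
    circleIntegral_of_hasSum_zpow (by norm_num) (fun z hz => hA z (by rw [hz]; norm_num)) m,
    circleIntegral_of_hasSum_zpow (by norm_num)
      (fun z hz => hB z (by rintro rfl; simp at hz) (by rw [hz]; norm_num)) m,
    sub_eq_sub_iff_sub_eq_sub, ← mul_sub, ← Finset.sum_sub_distrib] at hann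
  simp only [← mul_sub, circleIntegral_sub_one_zpow] at hann
  have h2 : (2 * Real.pi * I : ℂ) ≠ 0 := by simp [Real.pi_ne_zero]
  refine mul_left_cancel₀ h2 (hann.trans ?_)
  rw [Finset.mul_sum]
  exact Finset.sum_congr rfl fun i _ => by ring

/-- A function on the punctured plane which is an eigenvector of both Euler operators `z ∂/∂z`
and `z̄ ∂/∂z̄` is homogeneous. -/
lemma apply_exp_of_wdz_wdzbar {h : ℂ → ℂ} {α β : ℂ}
    (hd : ∀ z : ℂ, z ≠ 0 → DifferentiableAt ℝ h z)
    (h1 : ∀ z : ℂ, z ≠ 0 → z * wdz h z = α * h z)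
    (h2 : ∀ z : ℂ, z ≠ 0 → (starRingEnd ℂ) z * wdzbar h z = β * h z) (w : ℂ) :
    h (exp w) = exp (α * w + β * (starRingEnd ℂ) w) * h 1 := by
  set c := α * w + β * (starRingEnd ℂ) w with hc
  have hfd : ∀ z ζ : ℂ, fderiv ℝ h z ζ = ζ * wdz h z + (starRingEnd ℂ) ζ * wdzbar h z := by
    intro z ζ
    have : fderiv ℝ h z ζ = (ζ.re : ℂ) * fderiv ℝ h z 1 + (ζ.im : ℂ) * fderiv ℝ h z I := by
      conv_lhs => rw [show ζ = ζ.re • (1 : ℂ) + ζ.im • I by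
        simp [Complex.re_add_im]]
      rw [map_add, map_smul, map_smul]
      simp
    have hζ : ζ = ζ.re + ζ.im * I := (Complex.re_add_im ζ).symm
    have hζ' : (starRingEnd ℂ) ζ = ζ.re - ζ.im * I := by
      apply Complex.ext <;> simp
    rw [this, hζ', wdz, wdzbar]
    conv_rhs => rw [hζ]
    simp only [add_re, ofReal_re, mul_re, I_re, mul_zero, ofReal_im, I_im, mul_one, sub_self,
      add_zero, add_im, mul_im, zero_add]
    linear_combination ((ζ.im : ℂ) * fderiv ℝ h z I) * I_sq
  have hψ : ∀ t : ℝ, HasDerivAt (fun t : ℝ => h (exp (t * w)) * exp (-(t * c))) 0 t := by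
    intro t
    have he : HasDerivAt (fun t : ℝ => exp (t * w)) (exp (t * w) * w) t := by
      have := ((Complex.ofRealCLM.hasDerivAt (x := t)).mul_const w).cexp
      simpa using this
    have he' : HasDerivAt (fun t : ℝ => exp (-(t * c))) (exp (-(t * c)) * (-c)) t := by
      have := ((Complex.ofRealCLM.hasDerivAt (x := t)).mul_const c).neg.cexp
      simpa using this
    have hz : exp (t * w) ≠ 0 := exp_ne_zero _
    have := ((hd _ hz).hasFDerivAt.comp_hasDerivAt t he).mul he'
    have h0 : fderiv ℝ h (exp (t * w)) (exp (t * w) * w) * exp (-(t * c))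
        + h (exp (t * w)) * (exp (-(t * c)) * (-c)) = 0 := by
      rw [hfd, map_mul]
      linear_combination exp (-(t * c)) * (w * h1 _ hz + (starRingEnd ℂ) w * h2 _ hz)
        - h (exp (t * w)) * exp (-(t * c)) * hc
    exact h0 ▸ this
  have hconst := is_const_of_deriv_eq_zero (fun t => (hψ t).differentiableAt)
    (fun t => (hψ t).deriv) 1 0
  simp only [ofReal_one, one_mul, ofReal_zero, zero_mul, exp_zero, neg_zero, mul_one] at hconst
  rw [← hconst, mul_left_comm, ← exp_add]
  simp

lemma update_vecCons_zero {α : Type*} (a b c : α) :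
    Function.update ![a, b] 0 c = ![c, b] := by
  funext i
  fin_cases i <;> rfl

lemma update_vecCons_one {α : Type*} (a b c : α) :
    Function.update ![a, b] 1 c = ![a, c] := by
  funext i
  fin_cases i <;> rfl

namespace RxRFFA

variable (Φ : RxRFFA)

/-! ## The bigrading -/

lemma PLR_apply_of_mem {a b : ℝ} {x : Φ.g.F} (hx : Φ.PLR a b x = x) (p q : ℝ) :
    Φ.PLR p q x = if p = a ∧ q = b then x else 0 := by
  conv_lhs => rw [← hx]
  rw [PLR_orth, hx]

lemma PLR_idem (a b : ℝ) (x : Φ.g.F) : Φ.PLR a b (Φ.PLR a b x) = Φ.PLR a b x := by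
  rw [PLR_orth, if_pos ⟨rfl, rfl⟩]

lemma PLR_ext {x y : Φ.g.F} (h : ∀ p q, Φ.PLR p q x = Φ.PLR p q y) : x = y := by
  rw [← Φ.g.P_total x, ← Φ.g.P_total y]
  simp only [PLR_total, h]

lemma finsum_PLR (x : Φ.g.F) : ∑ᶠ s : ℝ × ℝ, Φ.PLR s.1 s.2 x = x := by
  refine Φ.PLR_ext fun p q => ?_
  rw [map_finsum _ (Φ.PLR_finite x), finsum_eq_single _ (p, q)]
  · rw [PLR_idem]
  · intro s hs
    rw [PLR_orth, if_neg]
    rintro ⟨h1, h2⟩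
    exact hs (Prod.ext h1.symm h2.symm)

lemma homogeneous_induction {C : Φ.g.F → Prop} (h0 : ∀ a b x, Φ.PLR a b x = x → C x)
    (hadd : ∀ x y, C x → C y → C (x + y)) (x : Φ.g.F) : C x := by
  rw [← Φ.finsum_PLR x]
  exact finsum_induction C (h0 0 0 0 (map_zero _)) hadd fun s => h0 _ _ _ (Φ.PLR_idem _ _ x)

lemma PLR_P (p q r : ℝ) (x : Φ.g.F) :
    Φ.PLR p q (Φ.g.P r x) = if r = p + q then Φ.PLR p q x else 0 := by
  have hfin : {p' : ℝ | Φ.PLR p' (r - p') x ≠ 0}.Finite :=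
    ((Φ.PLR_finite x).image Prod.fst).subset fun p' hp' => ⟨(p', r - p'), hp', rfl⟩
  rw [PLR_total, map_finsum _ hfin, finsum_eq_single _ p]
  · rw [PLR_orth]
    by_cases h : r = p + q
    · subst h
      simp
    · rw [if_neg h, if_neg]
      rintro ⟨-, h'⟩
      exact h (by linarith)
  · intro p' hp'
    rw [PLR_orth, if_neg]
    rintro ⟨h1, -⟩
    exact hp' h1.symm

lemma PLR_dLop (p q : ℝ) (x : Φ.g.F) : Φ.PLR p q (Φ.dLop x) = (p : ℂ) • Φ.PLR p q x := by
  induction x using Φ.homogeneous_induction with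
  | h0 a b x hx =>
    have : Φ.dLop x = (a : ℂ) • x := by rw [← hx, dLop_eq, hx]
    rw [this, map_smul, Φ.PLR_apply_of_mem hx]
    split_ifs with h
    · rw [h.1]
    · simp
  | hadd x y h1 h2 => simp only [map_add, smul_add, h1, h2]

lemma PLR_dRop (p q : ℝ) (x : Φ.g.F) : Φ.PLR p q (Φ.dRop x) = (q : ℂ) • Φ.PLR p q x := by
  induction x using Φ.homogeneous_induction with
  | h0 a b x hx =>
    have : Φ.dRop x = (b : ℂ) • x := by rw [← hx, dRop_eq, hx]
    rw [this, map_smul, Φ.PLR_apply_of_mem hx]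
    split_ifs with h
    · rw [h.2]
    · simp
  | hadd x y h1 h2 => simp only [map_add, smul_add, h1, h2]

lemma P_dLop {r : ℝ} {x : Φ.g.F} (hx : Φ.g.P r x = x) : Φ.g.P r (Φ.dLop x) = Φ.dLop x := by
  refine Φ.PLR_ext fun p q => ?_
  rw [PLR_P, PLR_dLop, ← hx, PLR_P]
  split_ifs <;> simp

lemma P_dRop {r : ℝ} {x : Φ.g.F} (hx : Φ.g.P r x = x) : Φ.g.P r (Φ.dRop x) = Φ.dRop x := by
  refine Φ.PLR_ext fun p q => ?_
  rw [PLR_P, PLR_dRop, ← hx, PLR_P]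
  split_ifs <;> simp

lemma dLop_of_mem {a b : ℝ} {x : Φ.g.F} (hx : Φ.PLR a b x = x) : Φ.dLop x = (a : ℂ) • x := by
  rw [← hx, dLop_eq]

lemma dRop_of_mem {a b : ℝ} {x : Φ.g.F} (hx : Φ.PLR a b x = x) : Φ.dRop x = (b : ℂ) • x := by
  rw [← hx, dRop_eq]

/-- The functional `φ` restricted to the homogeneous subspace of bidegree `(p, q)`. -/
def homDual (p q : ℝ) (φ : Φ.g.F →ₗ[ℂ] ℂ) : Φ.g.Dual :=
  ⟨φ ∘ₗ Φ.PLR p q, (Set.finite_singleton (p + q)).subset fun r hr => by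
    by_contra h
    refine hr (LinearMap.ext fun x => ?_)
    simp only [LinearMap.comp_apply, LinearMap.zero_apply]
    rw [PLR_P, if_neg (by simpa using h), map_zero]⟩

/-- The component of bidegree `(p, q)` of an element of the algebraic completion. -/
def component (p q : ℝ) (y : Φ.g.Fbar) : Φ.g.F := Φ.PLR p q (y (p + q))

lemma dpair_homDual (p q : ℝ) (φ : Φ.g.F →ₗ[ℂ] ℂ) {y : Φ.g.Fbar}
    (hy : ∀ r, Φ.g.P r (y r) = y r) :
    Φ.g.dpair (Φ.homDual p q φ) y = φ (Φ.component p q y) := by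
  unfold GradedSpace.dpair
  rw [finsum_eq_single _ (p + q)]
  · rfl
  · intro r hr
    change φ (Φ.PLR p q (y r)) = 0
    rw [← hy r, PLR_P, if_neg hr, map_zero]

/-! ## Bilinearity of the vertex operator map -/

/-- The full vertex operator map at `z` as a bilinear map. -/
def YLin (z : ℂ) : Φ.g.F →ₗ[ℂ] Φ.g.F →ₗ[ℂ] Φ.g.Fbar :=
  LinearMap.mk₂ ℂ (fun u v => Φ.toFullFieldAlgebra.Y u z v)
    (fun x y v => by
      simpa only [FullFieldAlgebra.Y, update_vecCons_zero] using Φ.m_add 2 ![x, v] 0 x y ![z, 0])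
    (fun c x v => by
      simpa only [FullFieldAlgebra.Y, update_vecCons_zero] using Φ.m_smul 2 ![x, v] 0 c x ![z, 0])
    (fun u x y => by
      simpa only [FullFieldAlgebra.Y, update_vecCons_one] using Φ.m_add 2 ![u, x] 1 x y ![z, 0])
    (fun c u x => by
      simpa only [FullFieldAlgebra.Y, update_vecCons_one] using Φ.m_smul 2 ![u, x] 1 c x ![z, 0])

/-- The component of bidegree `(p, q)` of the full vertex operator at `z`. -/
def Ycomp (z : ℂ) (p q : ℝ) : Φ.g.F →ₗ[ℂ] Φ.g.F →ₗ[ℂ] Φ.g.F :=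
  (Φ.YLin z).compr₂ (Φ.PLR p q ∘ₗ LinearMap.proj (p + q))

lemma Ycomp_apply (z : ℂ) (p q : ℝ) (u v : Φ.g.F) :
    Φ.Ycomp z p q u v = Φ.PLR p q (Φ.toFullFieldAlgebra.Y u z v (p + q)) := rfl

lemma PLR_Ycomp (z : ℂ) (p q : ℝ) (u v : Φ.g.F) :
    Φ.PLR p q (Φ.Ycomp z p q u v) = Φ.Ycomp z p q u v := Φ.PLR_idem _ _ _

lemma dpair_homDual_Y (p q : ℝ) (φ : Φ.g.F →ₗ[ℂ] ℂ) (u v : Φ.g.F) (z : ℂ) :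
    Φ.g.dpair (Φ.homDual p q φ) (Φ.toFullFieldAlgebra.Y u z v) = φ (Φ.Ycomp z p q u v) :=
  Φ.dpair_homDual p q φ fun r => Φ.m_graded 2 _ _ r

/-! ## Modes of vertex operators -/

/-- The contribution to `Ymode` of given bidegrees of the two arguments. -/
def modeTerm (l r : ℝ) (s : (ℝ × ℝ) × (ℝ × ℝ)) (u v : Φ.g.F) : Φ.g.F :=
  Φ.Ycomp 1 (s.1.1 + s.2.1 - l - 1) (s.1.2 + s.2.2 - r - 1) (Φ.PLR s.1.1 s.1.2 u)
    (Φ.PLR s.2.1 s.2.2 v)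

lemma modeTerm_finite (l r : ℝ) (u v : Φ.g.F) :
    (Function.support fun s => Φ.modeTerm l r s u v).Finite := by
  refine ((Φ.PLR_finite u).prod (Φ.PLR_finite v)).subset fun s hs => ⟨fun h => hs ?_, fun h => hs ?_⟩
  · simp only [modeTerm, h, map_zero, LinearMap.zero_apply]
  · simp only [modeTerm, h, map_zero]

lemma Ymode_eq_finsum (u : Φ.g.F) (l r : ℝ) (v : Φ.g.F) :
    Φ.Ymode u l r v = ∑ᶠ s, Φ.modeTerm l r s u v := by
  have hv : ∀ s : ℝ × ℝ, (Function.support fun t => Φ.modeTerm l r (s, t) u v).Finite := fun s =>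
    (Φ.PLR_finite v).subset fun t ht h => ht (by simp only [modeTerm, h, map_zero])
  have hu : (Function.support fun s => ∑ᶠ t, Φ.modeTerm l r (s, t) u v).Finite :=
    (Φ.PLR_finite u).subset fun s hs h => hs (by
      simp only [modeTerm, h, map_zero, LinearMap.zero_apply, finsum_zero])
  rw [finsum_curry _ (Φ.modeTerm_finite l r u v), finsum_curry _ hu]
  unfold Ymode
  refine finsum_congr fun a => finsum_congr fun b => ?_
  rw [finsum_curry _ (hv (a, b))]
  rfl

/-- The mode `𝕐_{l,r}` as a bilinear map. -/
def YmodeLin (l r : ℝ) : Φ.g.F →ₗ[ℂ] Φ.g.F →ₗ[ℂ] Φ.g.F :=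
  LinearMap.mk₂ ℂ (fun u v => Φ.Ymode u l r v)
    (fun x y v => by
      simp only [Ymode_eq_finsum]
      rw [← finsum_add_distrib (Φ.modeTerm_finite l r x v) (Φ.modeTerm_finite l r y v)]
      simp only [modeTerm, map_add, LinearMap.add_apply])
    (fun c x v => by
      simp only [Ymode_eq_finsum]
      rw [smul_finsum]
      simp only [modeTerm, map_smul, LinearMap.smul_apply])
    (fun u x y => by
      simp only [Ymode_eq_finsum]
      rw [← finsum_add_distrib (Φ.modeTerm_finite l r u x) (Φ.modeTerm_finite l r u y)]
      simp only [modeTerm, map_add])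
    (fun c u x => by
      simp only [Ymode_eq_finsum]
      rw [smul_finsum]
      simp only [modeTerm, map_smul])

lemma YmodeLin_apply (l r : ℝ) (u v : Φ.g.F) : Φ.YmodeLin l r u v = Φ.Ymode u l r v := rfl

lemma Ymode_of_mem {a b c d : ℝ} {u v : Φ.g.F} (hu : Φ.PLR a b u = u) (hv : Φ.PLR c d v = v)
    (l r : ℝ) : Φ.Ymode u l r v = Φ.Ycomp 1 (a + c - l - 1) (b + d - r - 1) u v := by
  rw [Ymode_eq_finsum, finsum_eq_single _ ((a, b), (c, d))]
  · simp only [modeTerm, hu, hv]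
  · intro s hs
    simp only [modeTerm]
    by_cases h1 : s.1.1 = a ∧ s.1.2 = b
    · have h2 : ¬ (s.2.1 = c ∧ s.2.2 = d) := fun h2 =>
        hs (Prod.ext (Prod.ext h1.1 h1.2) (Prod.ext h2.1 h2.2))
      rw [Φ.PLR_apply_of_mem hv, if_neg h2, map_zero]
    · rw [Φ.PLR_apply_of_mem hu, if_neg h1, map_zero, LinearMap.zero_apply]

lemma PLR_Ymode {a b c d : ℝ} {u v : Φ.g.F} (hu : Φ.PLR a b u = u) (hv : Φ.PLR c d v = v)
    (l r : ℝ) :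
    Φ.PLR (a + c - l - 1) (b + d - r - 1) (Φ.Ymode u l r v) = Φ.Ymode u l r v := by
  rw [Φ.Ymode_of_mem hu hv, PLR_Ycomp]

lemma PLR_Ymode_eq {c d : ℝ} {v : Φ.g.F} (hv : Φ.PLR c d v = v) (p q l r : ℝ) (u : Φ.g.F) :
    Φ.PLR p q (Φ.Ymode u l r v) = Φ.Ymode (Φ.PLR (p + l + 1 - c) (q + r + 1 - d) u) l r v := by
  simp only [← YmodeLin_apply]
  induction u using Φ.homogeneous_induction with
  | h0 a b u hu =>
    rw [Φ.PLR_apply_of_mem hu, YmodeLin_apply, Φ.PLR_apply_of_mem (Φ.PLR_Ymode hu hv l r)]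
    have : (p = a + c - l - 1 ∧ q = b + d - r - 1)
        ↔ (p + l + 1 - c = a ∧ q + r + 1 - d = b) := by
      constructor <;> rintro ⟨h1, h2⟩ <;> constructor <;> linarith
    simp only [this]
    split_ifs
    · rfl
    · simp
  | hadd x y h1 h2 => simp only [map_add, LinearMap.add_apply, h1, h2]

/-- Dependence of the components of `𝕐(u; z, z̄)v` on `z`. -/
lemma Ycomp_exp {a b c d : ℝ} {u v : Φ.g.F} (hu : Φ.PLR a b u = u) (hv : Φ.PLR c d v = v)
    (p q : ℝ) (w : ℂ) :
    Φ.Ycomp (exp w) p q u v = exp (((p - a - c : ℝ) : ℂ) * w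
      + ((q - b - d : ℝ) : ℂ) * (starRingEnd ℂ) w) • Φ.Ycomp 1 p q u v := by
  rw [← sub_eq_zero, ← Module.forall_dual_apply_eq_zero_iff ℂ]
  intro φ
  rw [map_sub, map_smul, sub_eq_zero, smul_eq_mul]
  have hfun : (fun z => Φ.g.dpair (Φ.homDual p q φ) (Φ.toFullFieldAlgebra.Y u z v))
      = fun z => φ (Φ.Ycomp z p q u v) := funext fun z => Φ.dpair_homDual_Y p q φ u v z
  refine apply_exp_of_wdz_wdzbar (h := fun z => φ (Φ.Ycomp z p q u v)) ?_ ?_ ?_ w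
  · intro z hz
    rw [← hfun]
    have h1 := Φ.m_smooth 2 ![u, v] (Φ.homDual p q φ)
    have hinj : ∀ z : ℂ, z ≠ 0 → Function.Injective ![z, 0] := by
      intro z hz i j hij
      fin_cases i <;> fin_cases j <;> simp_all
    have h2 : ContDiff ℝ (⊤ : ℕ∞) fun z : ℂ => (![z, 0] : Fin 2 → ℂ) :=
      contDiff_pi.2 fun i => by
        fin_cases i
        · exact contDiff_id
        · exact contDiff_const
    have h3 := h1.comp (s := {z : ℂ | z ≠ 0}) h2.contDiffOn fun z hz => hinj z hz
    exact (h3.differentiableOn (by simp) z hz).differentiableAt (isOpen_ne.mem_nhds hz)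
  · intro z hz
    have h := Φ.dL_bracket u v (Φ.homDual p q φ) z hz
    rw [Φ.dLop_of_mem hu, Φ.dLop_of_mem hv, Φ.dpair_homDual_Y, Φ.dpair_homDual_Y, hfun,
      Φ.dpair_homDual p q φ] at h
    · simp only [component, PLR_dLop, ← Ycomp_apply, map_smul, LinearMap.smul_apply,
        smul_eq_mul] at h
      push_cast
      linear_combination -h
    · exact fun r => Φ.P_dLop (Φ.m_graded 2 _ _ r)
  · intro z hz
    have h := Φ.dR_bracket u v (Φ.homDual p q φ) z hz
    rw [Φ.dRop_of_mem hu, Φ.dRop_of_mem hv, Φ.dpair_homDual_Y, Φ.dpair_homDual_Y, hfun,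
      Φ.dpair_homDual p q φ] at h
    · simp only [component, PLR_dRop, ← Ycomp_apply, map_smul, LinearMap.smul_apply,
        smul_eq_mul] at h
      push_cast
      linear_combination -h
    · exact fun r => Φ.P_dRop (Φ.m_graded 2 _ _ r)

lemma mem_of_dLop_dRop {p q : ℝ} {x : Φ.g.F} (hL : Φ.dLop x = (p : ℂ) • x)
    (hR : Φ.dRop x = (q : ℂ) • x) : Φ.PLR p q x = x := by
  refine Φ.PLR_ext fun p' q' => ?_
  have h1 := Φ.PLR_dLop p' q' x
  have h2 := Φ.PLR_dRop p' q' x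
  rw [hL, map_smul, ← sub_eq_zero, ← sub_smul, smul_eq_zero, sub_eq_zero] at h1
  rw [hR, map_smul, ← sub_eq_zero, ← sub_smul, smul_eq_zero, sub_eq_zero] at h2
  rw [PLR_orth]
  split_ifs with h
  · rw [h.1, h.2]
  · rcases h1 with h1 | h1
    · rcases h2 with h2 | h2
      · exact absurd ⟨(ofReal_injective h1).symm, (ofReal_injective h2).symm⟩ h
      · exact h2.symm
    · exact h1.symm

/-! ## Convergence of products and iterates -/

lemma m_one_component (a b : ℝ) (x : Φ.g.F) (s : ℝ × ℝ) (hx : Φ.PLR a b x = x) :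
    Φ.PLR s.1 s.2 (Φ.m 1 (fun _ => x) (fun _ => 0) (s.1 + s.2)) = if s = (a, b) then x else 0 := by
  rw [Φ.m_one, GradedSpace.incl, PLR_P, if_pos rfl, Φ.PLR_apply_of_mem hx]
  simp only [Prod.ext_iff]

/-- The indexing of the three arguments of a product `𝕐(x; z₁)𝕐(y; z₂)v`. -/
def prodEquiv : (Σ i : Fin 2, Fin (![1, 2] i)) ≃ Fin 3 where
  toFun s := match s with
    | ⟨0, _⟩ => 0
    | ⟨1, j⟩ => Fin.succ (n := 2) j
  invFun i := match i with
    | 0 => ⟨0, (0 : Fin 1)⟩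
    | 1 => ⟨1, (0 : Fin 2)⟩
    | 2 => ⟨1, (1 : Fin 2)⟩
  left_inv := by
    rintro ⟨i, j⟩
    fin_cases i
    · have : j = (0 : Fin 1) := Subsingleton.elim (α := Fin 1) _ _
      subst this
      rfl
    · change Fin 2 at j
      fin_cases j <;> rfl
  right_inv i := by fin_cases i <;> rfl

/-- The indexing of the three arguments of an iterate `𝕐(𝕐(x; z₁ - z₂)y; z₂)v`. -/
def iterEquiv : (Σ i : Fin 2, Fin (![2, 1] i)) ≃ Fin 3 where
  toFun s := match s with
    | ⟨0, j⟩ => Fin.castSucc (n := 2) j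
    | ⟨1, _⟩ => 2
  invFun i := match i with
    | 0 => ⟨0, (0 : Fin 2)⟩
    | 1 => ⟨0, (1 : Fin 2)⟩
    | 2 => ⟨1, (0 : Fin 1)⟩
  left_inv := by
    rintro ⟨i, j⟩
    fin_cases i
    · change Fin 2 at j
      fin_cases j <;> rfl
    · have : j = (0 : Fin 1) := Subsingleton.elim (α := Fin 1) _ _
      subst this
      rfl
  right_inv i := by fin_cases i <;> rfl

/-- The family of two tuples of lengths `1` and `2`. -/
def prodTuple {α : Type*} (s : Fin 1 → α) (t : Fin 2 → α) : ∀ i : Fin 2, Fin (![1, 2] i) → α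
  | 0 => s
  | 1 => t

/-- The family of two tuples of lengths `2` and `1`. -/
def iterTuple {α : Type*} (s : Fin 2 → α) (t : Fin 1 → α) : ∀ i : Fin 2, Fin (![2, 1] i) → α
  | 0 => s
  | 1 => t

lemma dpair_m_three (p q : ℝ) (φ : Φ.g.F →ₗ[ℂ] ℂ) (u : Fin 3 → Φ.g.F) (z : Fin 3 → ℂ) :
    Φ.g.dpair (Φ.homDual p q φ) (Φ.m 3 u z) = φ (Φ.component p q (Φ.m 3 u z)) :=
  Φ.dpair_homDual p q φ fun r => Φ.m_graded 3 _ _ r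

lemma hasSum_prod {a b : ℝ} {x : Φ.g.F} (hx : Φ.PLR a b x = x) (y v : Φ.g.F) {z1 z2 : ℂ}
    (hz : ‖z2‖ < ‖z1‖) (p q : ℝ) (φ : Φ.g.F →ₗ[ℂ] ℂ) :
    HasSum (fun s : ℝ × ℝ => φ (Φ.Ycomp z1 p q x (Φ.Ycomp z2 s.1 s.2 y v)))
      (φ (Φ.component p q (Φ.m 3 ![x, y, v] ![z1, z2, 0]))) := by
  obtain ⟨hs, ht⟩ := Φ.m_conv2 2 ![1, 2] (prodTuple (fun _ => x) ![y, v]) ![z1, 0]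
    (prodTuple (fun _ => 0) ![z2, 0]) prodEquiv (by
      have hz0 : 0 < ‖z1‖ := (norm_nonneg _).trans_lt hz
      intro i j hij
      fin_cases i <;> fin_cases j
      · exact absurd rfl hij
      · intro _ q
        change Fin 2 at q
        fin_cases q <;> simpa [prodTuple, ← norm_pos_iff]
      · intro q _
        change Fin 2 at q
        fin_cases q <;> simpa [prodTuple, ← norm_pos_iff]
      · exact absurd rfl hij) (Φ.homDual p q φ)
  have hu : (fun j : Fin 3 => prodTuple (fun _ => x) ![y, v] (prodEquiv.symm j).1
      (prodEquiv.symm j).2) = ![x, y, v] := by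
    funext j
    fin_cases j <;> rfl
  have hzz : (fun j : Fin 3 => prodTuple (fun _ => 0) ![z2, 0] (prodEquiv.symm j).1
      (prodEquiv.symm j).2 + (![z1, 0] : Fin 2 → ℂ) (prodEquiv.symm j).1) = ![z1, z2, 0] := by
    funext j
    fin_cases j
    · exact zero_add z1
    · exact add_zero z2
    · exact add_zero 0
  have h := hs.of_norm.hasSum
  rw [ht.trans (congrArg₂ (fun u z => Φ.g.dpair (Φ.homDual p q φ) (Φ.m 3 u z)) hu hzz),
    dpair_m_three] at h
  have hinj : Function.Injective fun s : ℝ × ℝ => ![(a, b), s] := fun s t hst => congrFun hst 1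
  have harg : ∀ r : Fin 2 → ℝ × ℝ, (fun i => Φ.PLR (r i).1 (r i).2
      (Φ.m (![1, 2] i) (prodTuple (fun _ => x) ![y, v] i) (prodTuple (fun _ => 0) ![z2, 0] i)
        ((r i).1 + (r i).2)))
      = ![if r 0 = (a, b) then x else 0, Φ.Ycomp z2 (r 1).1 (r 1).2 y v] := by
    intro r
    funext i
    fin_cases i
    · exact Φ.m_one_component a b x (r 0) hx
    · rfl
  simp only [harg] at h
  rw [← hinj.hasSum_iff] at h
  · convert h using 2 with s
    · rfl
    simp only [Function.comp_apply, Matrix.cons_val_zero, Matrix.cons_val_one, if_pos]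
    exact (Φ.dpair_homDual_Y p q φ _ _ z1).symm
  · intro r hr
    rw [if_neg]
    · exact (Φ.dpair_homDual_Y p q φ _ _ z1).trans (by simp)
    · rintro h0
      refine hr ⟨r 1, ?_⟩
      funext i
      fin_cases i
      · exact h0.symm
      · rfl

lemma hasSum_iter {c d : ℝ} {v : Φ.g.F} (hv : Φ.PLR c d v = v) (x y : Φ.g.F) {z1 z2 : ℂ}
    (hz : ‖z1 - z2‖ < ‖z2‖) (p q : ℝ) (φ : Φ.g.F →ₗ[ℂ] ℂ) :
    HasSum (fun s : ℝ × ℝ => φ (Φ.Ycomp z2 p q (Φ.Ycomp (z1 - z2) s.1 s.2 x y) v))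
      (φ (Φ.component p q (Φ.m 3 ![x, y, v] ![z1, z2, 0]))) := by
  obtain ⟨hs, ht⟩ := Φ.m_conv2 2 ![2, 1] (iterTuple ![x, y] (fun _ => v)) ![z2, 0]
    (iterTuple ![z1 - z2, 0] (fun _ => 0)) iterEquiv (by
      have hz0 : 0 < ‖z2‖ := (norm_nonneg _).trans_lt hz
      intro i j hij
      fin_cases i <;> fin_cases j
      · exact absurd rfl hij
      · intro q _
        change Fin 2 at q
        fin_cases q <;> simpa [iterTuple, ← norm_pos_iff]
      · intro _ q
        change Fin 2 at q
        fin_cases q <;> simpa [iterTuple, ← norm_pos_iff]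
      · exact absurd rfl hij) (Φ.homDual p q φ)
  have hu : (fun j : Fin 3 => iterTuple ![x, y] (fun _ => v) (iterEquiv.symm j).1
      (iterEquiv.symm j).2) = ![x, y, v] := by
    funext j
    fin_cases j <;> rfl
  have hzz : (fun j : Fin 3 => iterTuple ![z1 - z2, 0] (fun _ => 0) (iterEquiv.symm j).1
      (iterEquiv.symm j).2 + (![z2, 0] : Fin 2 → ℂ) (iterEquiv.symm j).1) = ![z1, z2, 0] := by
    funext j
    fin_cases j
    · exact sub_add_cancel z1 z2
    · exact zero_add z2
    · exact add_zero 0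
  have h := hs.of_norm.hasSum
  rw [ht.trans (congrArg₂ (fun u z => Φ.g.dpair (Φ.homDual p q φ) (Φ.m 3 u z)) hu hzz),
    dpair_m_three] at h
  have hinj : Function.Injective fun s : ℝ × ℝ => ![s, (c, d)] := fun s t hst => congrFun hst 0
  have harg : ∀ r : Fin 2 → ℝ × ℝ, (fun i => Φ.PLR (r i).1 (r i).2
      (Φ.m (![2, 1] i) (iterTuple ![x, y] (fun _ => v) i) (iterTuple ![z1 - z2, 0] (fun _ => 0) i)
        ((r i).1 + (r i).2)))
      = ![Φ.Ycomp (z1 - z2) (r 0).1 (r 0).2 x y, if r 1 = (c, d) then v else 0] := by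
    intro r
    funext i
    fin_cases i
    · rfl
    · exact Φ.m_one_component c d v (r 1) hv
  simp only [harg] at h
  rw [← hinj.hasSum_iff] at h
  · convert h using 2 with s
    · rfl
    simp only [Function.comp_apply, Matrix.cons_val_zero, Matrix.cons_val_one, if_pos]
    exact (Φ.dpair_homDual_Y p q φ _ _ z2).symm
  · intro r hr
    rw [if_neg]
    · exact (Φ.dpair_homDual_Y p q φ _ _ z2).trans (by simp)
    · rintro h0
      refine hr ⟨r 0, ?_⟩
      funext i
      fin_cases i
      · rfl
      · exact h0.symm

/-- Every component of a correlation function of three fields is smooth in the first variable. -/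
lemma contDiffOn_component_m_three (p q : ℝ) (φ : Φ.g.F →ₗ[ℂ] ℂ) (x y v : Φ.g.F) :
    ContDiffOn ℝ 1 (fun z => φ (Φ.component p q (Φ.m 3 ![x, y, v] ![z, 1, 0])))
      {z | z ≠ 0 ∧ z ≠ 1} := by
  have h1 := Φ.m_smooth 3 ![x, y, v] (Φ.homDual p q φ)
  have hinj : ∀ z : ℂ, z ≠ 0 ∧ z ≠ 1 → Function.Injective ![z, 1, 0] := by
    rintro z ⟨h0, h1⟩ i j hij
    fin_cases i <;> fin_cases j <;> simp_all
  have h2 : ContDiff ℝ (⊤ : ℕ∞) fun z : ℂ => (![z, 1, 0] : Fin 3 → ℂ) :=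
    contDiff_pi.2 fun i => by
      fin_cases i
      · exact contDiff_id
      · exact contDiff_const
      · exact contDiff_const
  have h3 := h1.comp (s := {z : ℂ | z ≠ 0 ∧ z ≠ 1}) h2.contDiffOn fun z hz => hinj z hz
  simp only [Function.comp_def, dpair_m_three] at h3
  exact h3.of_le (by exact_mod_cast le_top)

lemma m_three_swap (x y v : Φ.g.F) (z1 z2 z3 : ℂ) :
    Φ.m 3 ![y, x, v] ![z2, z1, z3] = Φ.m 3 ![x, y, v] ![z1, z2, z3] := by
  have h := Φ.m_perm 3 (Equiv.swap 0 1) ![x, y, v] ![z1, z2, z3]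
  have h1 : ∀ {α : Type} (a b c : α), (fun i => ![a, b, c] ((Equiv.swap 0 1 : Equiv.Perm (Fin 3)) i))
      = ![b, a, c] := by
    intro α a b c
    funext i
    fin_cases i <;> rfl
  rwa [h1, h1] at h

end RxRFFA

namespace ConfFFA

variable (Φ : ConfFFA)

lemma PLR_LL {c d : ℝ} {v : Φ.g.F} (hv : Φ.PLR c d v = v) (n : ℤ) :
    Φ.PLR (c - n) d (Φ.LL n v) = Φ.LL n v := by
  apply Φ.mem_of_dLop_dRop
  · have h := Φ.virL 0 n v
    rw [← Φ.dL_L0, ← Φ.dL_L0, Φ.dLop_of_mem hv, map_smul, zero_add, sub_eq_iff_eq_add] at h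
    rw [h]
    have : (if n = 0 then Φ.cL / 12 * (((0 : ℤ) : ℂ) ^ 3 - ((0 : ℤ) : ℂ)) else 0) = 0 := by simp
    rw [this, zero_smul, add_zero, ← add_smul]
    congr 1
    push_cast
    ring
  · rw [Φ.dR_L0, ← Φ.virLR, ← Φ.dR_L0, Φ.dRop_of_mem hv, map_smul]

/-- The component of bidegree `(2, 0)` of the left conformal element. -/
def ωL' : Φ.g.F := Φ.PLR 2 0 Φ.ωL

lemma PLR_ωL' : Φ.PLR 2 0 Φ.ωL' = Φ.ωL' := Φ.PLR_idem _ _ _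

lemma Ymode_ωL' {c d : ℝ} {v : Φ.g.F} (hv : Φ.PLR c d v = v) (l r : ℝ) :
    Φ.Ymode Φ.ωL' l r v = Φ.PLR (2 + c - l - 1) (d - r - 1) (Φ.Ymode Φ.ωL l r v) := by
  rw [Φ.PLR_Ymode_eq hv]
  congr 1
  rw [ωL']
  congr 2 <;> ring

lemma Ycomp_one_ωL' {c d : ℝ} {v : Φ.g.F} (hv : Φ.PLR c d v = v) (p q : ℝ) :
    Φ.Ycomp 1 p q Φ.ωL' v = Φ.PLR p q (Φ.Ymode Φ.ωL (2 + c - p - 1) (d - q - 1) v) := by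
  have h1 := Φ.Ymode_of_mem Φ.PLR_ωL' hv (2 + c - p - 1) (d - q - 1)
  have h2 : 2 + c - (2 + c - p - 1) - 1 = p := by ring
  have h3 : 0 + d - (d - q - 1) - 1 = q := by ring
  have h4 : d - (d - q - 1) - 1 = q := by ring
  rw [h2, h3] at h1
  rw [← h1, Φ.Ymode_ωL' hv, h2, h4]

/-- The operators `L^L(n)` are the coefficients of the expansion of `𝕐(ω^L; z, z̄)`. -/
lemma Ycomp_ωL' {c d : ℝ} {v : Φ.g.F} (hv : Φ.PLR c d v = v) {z : ℂ} (hz : z ≠ 0) (n : ℤ) :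
    Φ.Ycomp z (c - n) d Φ.ωL' v = z ^ (-n - 2) • Φ.LL n v := by
  have h := Φ.Ycomp_exp Φ.PLR_ωL' hv (c - n) d (log z)
  rw [exp_log hz] at h
  rw [h, Φ.Ycomp_one_ωL' hv]
  have h1 : 2 + c - (c - n) - 1 = (n : ℝ) + 1 := by ring
  have h2 : d - d - 1 = (-1 : ℝ) := by ring
  have h3 : ((c - n - 2 - c : ℝ) : ℂ) = ((-n - 2 : ℤ) : ℂ) := by push_cast; ring
  have h4 : ((d - 0 - d : ℝ) : ℂ) = 0 := by push_cast; ring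
  rw [h1, h2, ← Φ.LL_eq, Φ.PLR_LL hv, h3, h4, zero_mul, add_zero, exp_int_mul, exp_log hz]

lemma Ycomp_ωL'_eq_zero {c d : ℝ} {v : Φ.g.F} (hv : Φ.PLR c d v = v) {z : ℂ} (hz : z ≠ 0)
    {p q : ℝ} (h : ¬ ∃ n : ℤ, (p, q) = (c - n, d)) : Φ.Ycomp z p q Φ.ωL' v = 0 := by
  have h0 := Φ.Ycomp_exp Φ.PLR_ωL' hv p q (log z)
  rw [exp_log hz, Φ.Ycomp_one_ωL' hv, Φ.ωL_modes, map_zero, smul_zero] at h0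
  · exact h0
  · rintro ⟨h1, n, h2⟩
    exact h ⟨n, Prod.ext (by simp only; linarith) (by simp only; linarith)⟩

/-- A vector is annihilated by `L^L(i - 1)` for large `i`. -/
lemma exists_LL_eq_zero (u : Φ.g.F) : ∃ K : ℕ, ∀ i : ℕ, K ≤ i → Φ.LL ((i : ℤ) - 1) u = 0 := by
  induction u using Φ.homogeneous_induction with
  | h0 a b u hu =>
    obtain ⟨M, hM⟩ := Φ.grading_res.1
    obtain ⟨K, hK⟩ := exists_nat_gt (a + 1 - M)
    refine ⟨K, fun i hi => ?_⟩
    rw [← Φ.PLR_LL hu, hM _ _ (Or.inl ?_), LinearMap.zero_apply]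
    have : (K : ℝ) ≤ i := by exact_mod_cast hi
    push_cast
    linarith
  | hadd x y hx hy =>
    obtain ⟨K, hK⟩ := hx
    obtain ⟨K', hK'⟩ := hy
    exact ⟨max K K', fun i hi => by
      rw [map_add, hK i (le_of_max_le_left hi), hK' i (le_of_max_le_right hi), add_zero]⟩

lemma injective_sub_intCast (c d : ℝ) : Function.Injective fun n : ℤ => (c - (n : ℝ), d) := by
  intro m n h
  simpa using h

/-- The left commutator formula applied to homogeneous vectors. -/
lemma commutator_left_of_mem {a b c d : ℝ} {u v : Φ.g.F} (hu : Φ.PLR a b u = u)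
    (hv : Φ.PLR c d v = v) (mm : ℤ) (l r : ℝ) :
    Φ.LL mm (Φ.Ymode u l r v) - Φ.Ymode u l r (Φ.LL mm v)
      = ∑ᶠ i : ℕ, cchoose ((mm : ℂ) + 1) i •
          Φ.Ymode (Φ.LL ((i : ℤ) - 1) u) (l + (mm : ℝ) + 1 - (i : ℝ)) r v := by
  obtain ⟨K, hK⟩ := Φ.exists_LL_eq_zero u
  have hterm : ∀ i : ℕ, K ≤ i → ∀ l' : ℝ, Φ.Ymode (Φ.LL ((i : ℤ) - 1) u) l' r v = 0 := by
    intro i hi l'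
    rw [hK i hi, ← Φ.YmodeLin_apply, map_zero, LinearMap.zero_apply]
  rw [finsum_eq_sum_of_support_subset (s := Finset.range K)]
  swap
  · intro i hi
    by_contra h
    rw [Finset.coe_range, Set.mem_Iio, not_lt] at h
    exact hi (by simp only [hterm i h, smul_zero])
  rw [← sub_eq_zero, ← Module.forall_dual_apply_eq_zero_iff ℂ]
  intro φ
  rw [map_sub, sub_eq_zero, map_sub, map_sum]
  simp only [map_smul, smul_eq_mul]
  set p : ℝ := a + c - l - 1 - mm with hp
  set q : ℝ := b + d - r - 1 with hq
  have key := laurent_coeff_sub_eq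
    (A := fun n => φ (Φ.LL n (Φ.Ymode u (a + c - (p + n) - 1) r v)))
    (B := fun n => φ (Φ.Ymode u (a + (c - n) - p - 1) r (Φ.LL n v)))
    (C := fun n => φ (Φ.Ymode (Φ.LL n u) (a - n + c - p - 1) r v)) K
    (Φ.contDiffOn_component_m_three p q φ Φ.ωL' u v) ?_ ?_ ?_
    (fun i hi => by simp only [hterm i hi, map_zero]) mm
  · have h1 : a + c - (p + mm) - 1 = l := by rw [hp]; ring
    have h2 : a + (c - mm) - p - 1 = l := by rw [hp]; ring
    have h3 : ∀ i : ℕ, a - (((i : ℤ) - 1 : ℤ) : ℝ) + c - p - 1 = l + mm + 1 - i := by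
      intro i
      rw [hp]
      push_cast
      ring
    simpa only [h1, h2, h3] using key
  · intro z hz
    have hz0 : z ≠ 0 := norm_pos_iff.1 (zero_lt_one.trans hz)
    have h := Φ.hasSum_prod Φ.PLR_ωL' u v (z1 := z) (z2 := 1) (by rwa [norm_one]) p q φ
    have hinj : Function.Injective fun n : ℤ => (p + (n : ℝ), q) := by
      intro m n h
      simpa using h
    rw [← hinj.hasSum_iff] at h
    · convert h using 2 with n
      have h1 := Φ.Ymode_of_mem hu hv (a + c - (p + n) - 1) r
      have h2 : a + c - (a + c - (p + n) - 1) - 1 = p + n := by ring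
      rw [h2, ← hq] at h1
      have h3 := Φ.Ycomp_ωL' (Φ.PLR_Ycomp 1 (p + n) q u v) hz0 n
      rw [add_sub_cancel_right] at h3
      simp only [Function.comp_apply]
      rw [h3, h1, map_smul, smul_eq_mul, mul_comm]
    · rintro ⟨s, t⟩ hs
      rw [Φ.Ycomp_ωL'_eq_zero (Φ.PLR_Ycomp _ _ _ _ _) hz0, map_zero]
      rintro ⟨n, hn⟩
      simp only [Prod.mk.injEq] at hn
      exact hs ⟨n, Prod.ext (by simp only; linarith) hn.2⟩
  · intro z hz0 hz
    have h := Φ.hasSum_prod hu Φ.ωL' v (z1 := 1) (z2 := z) (by rwa [norm_one]) p q φ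
    rw [Φ.m_three_swap, ← (injective_sub_intCast c d).hasSum_iff] at h
    · convert h using 2 with n
      have h1 := Φ.Ymode_of_mem hu (Φ.PLR_LL hv n) (a + (c - n) - p - 1) r
      have h2 : a + (c - n) - (a + (c - n) - p - 1) - 1 = p := by ring
      rw [h2, ← hq] at h1
      simp only [Function.comp_apply]
      rw [Φ.Ycomp_ωL' hv hz0, h1, map_smul, map_smul, smul_eq_mul, mul_comm]
    · rintro ⟨s, t⟩ hs
      rw [Φ.Ycomp_ωL'_eq_zero hv hz0, map_zero, map_zero]
      rintro ⟨n, hn⟩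
      exact hs ⟨n, hn.symm⟩
  · intro z hz1 hz
    have hz0 : z - 1 ≠ 0 := sub_ne_zero.2 hz1
    have h := Φ.hasSum_iter hv Φ.ωL' u (z1 := z) (z2 := 1) (by rwa [norm_one]) p q φ
    rw [← (injective_sub_intCast a b).hasSum_iff] at h
    · convert h using 2 with n
      have h1 := Φ.Ymode_of_mem (Φ.PLR_LL hu n) hv (a - n + c - p - 1) r
      have h2 : a - n + c - (a - n + c - p - 1) - 1 = p := by ring
      rw [h2, ← hq] at h1
      simp only [Function.comp_apply]
      rw [Φ.Ycomp_ωL' hu hz0, h1, map_smul, LinearMap.smul_apply, map_smul, smul_eq_mul, mul_comm]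
    · rintro ⟨s, t⟩ hs
      rw [Φ.Ycomp_ωL'_eq_zero hu hz0, map_zero, LinearMap.zero_apply, map_zero]
      rintro ⟨n, hn⟩
      exact hs ⟨n, hn.symm⟩

/-- The left commutator formula. -/
lemma commutator_left (u v : Φ.g.F) (mm : ℤ) (l r : ℝ) :
    Φ.LL mm (Φ.Ymode u l r v) - Φ.Ymode u l r (Φ.LL mm v)
      = ∑ᶠ i : ℕ, cchoose ((mm : ℂ) + 1) i •
          Φ.Ymode (Φ.LL ((i : ℤ) - 1) u) (l + (mm : ℝ) + 1 - (i : ℝ)) r v := by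
  have hfin : ∀ u v : Φ.g.F, (Function.support fun i : ℕ => cchoose ((mm : ℂ) + 1) i •
      Φ.YmodeLin (l + (mm : ℝ) + 1 - (i : ℝ)) r (Φ.LL ((i : ℤ) - 1) u) v).Finite := by
    intro u v
    obtain ⟨K, hK⟩ := Φ.exists_LL_eq_zero u
    refine (Set.finite_lt_nat K).subset fun i hi => ?_
    by_contra h
    exact hi (by simp only [hK i (not_lt.1 h), map_zero, LinearMap.zero_apply, smul_zero])
  simp only [← Φ.YmodeLin_apply]
  induction u using Φ.homogeneous_induction with
  | h0 a b u hu =>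
    induction v using Φ.homogeneous_induction with
    | h0 c d v hv => exact Φ.commutator_left_of_mem hu hv mm l r
    | hadd x y hx hy =>
      simp only [map_add, smul_add]
      rw [finsum_add_distrib (hfin u x) (hfin u y), ← hx, ← hy]
      abel
  | hadd x y hx hy =>
    simp only [map_add, LinearMap.add_apply, smul_add]
    rw [finsum_add_distrib (hfin x v) (hfin y v), ← hx, ← hy]
    abel

end ConfFFA

/-! ## Exchanging the holomorphic and antiholomorphic variables -/

lemma fderiv_comp_conj (h : ℂ → ℂ) (z ζ : ℂ) :
    fderiv ℝ (fun w => h ((starRingEnd ℂ) w)) z ζ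
      = fderiv ℝ h ((starRingEnd ℂ) z) ((starRingEnd ℂ) ζ) := by
  have := conjCLE.comp_right_fderiv (f := h) (x := z)
  exact DFunLike.congr_fun this ζ

lemma wdz_comp_conj (h : ℂ → ℂ) (z : ℂ) :
    wdz (fun w => h ((starRingEnd ℂ) w)) z = wdzbar h ((starRingEnd ℂ) z) := by
  rw [wdz, wdzbar, fderiv_comp_conj, fderiv_comp_conj]
  simp

lemma wdzbar_comp_conj (h : ℂ → ℂ) (z : ℂ) :
    wdzbar (fun w => h ((starRingEnd ℂ) w)) z = wdz h ((starRingEnd ℂ) z) := by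
  rw [wdz, wdzbar, fderiv_comp_conj, fderiv_comp_conj]
  simp [sub_eq_add_neg]

/-- The full field algebra with conjugate variables. -/
abbrev FullFieldAlgebra.swap (Φ : FullFieldAlgebra) : FullFieldAlgebra where
  g := Φ.g
  m n u z := Φ.m n u fun i => (starRingEnd ℂ) (z i)
  vac := Φ.vac
  m_graded n u z r := Φ.m_graded n u _ r
  m_add n u i x y z := Φ.m_add n u i x y _
  m_smul n u i c x z := Φ.m_smul n u i c x _
  m_smooth n u f := by
    have h : ContDiff ℝ (⊤ : ℕ∞) fun z : Fin n → ℂ => fun i => (starRingEnd ℂ) (z i) :=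
      contDiff_pi.2 fun i => conjCLE.contDiff.comp (contDiff_apply ℝ ℂ i)
    exact (Φ.m_smooth n u f).comp h.contDiffOn fun z hz i j hij =>
      hz ((starRingEnd ℂ).injective hij)
  m_one u := by simpa using Φ.m_one u
  m_vac n u z w := by
    rw [← Φ.m_vac n u _ ((starRingEnd ℂ) w)]
    congr 1
    funext i
    refine Fin.lastCases ?_ (fun j => ?_) i <;> simp
  m_perm n σ u z := Φ.m_perm n σ u fun i => (starRingEnd ℂ) (z i)
  m_conv k l u z0 z e h f := by
    simpa only [map_add] using Φ.m_conv k l u (fun i => (starRingEnd ℂ) (z0 i))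
      (fun i j => (starRingEnd ℂ) (z i j)) e
      (fun i j hij p q => by simpa only [← map_sub, RCLike.norm_conj] using h i j hij p q) f
  m_grading a n u z r := by
    rw [Φ.m_grading]
    simp [← exp_conj]

lemma FullFieldAlgebra.swap_Y (Φ : FullFieldAlgebra) (u : Φ.g.F) (z : ℂ) (v : Φ.g.F) :
    Φ.swap.Y u z v = Φ.Y u ((starRingEnd ℂ) z) v := by
  change Φ.m 2 ![u, v] _ = Φ.m 2 ![u, v] _
  congr 1
  funext i
  fin_cases i
  · rfl
  · exact map_zero _

namespace RxRFFA

/-- The `ℝ × ℝ`-graded full field algebra with the left and right structures exchanged. -/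
def swap (Φ : RxRFFA) : RxRFFA where
  toFullFieldAlgebra := Φ.toFullFieldAlgebra.swap
  PLR p q := Φ.PLR q p
  PLR_orth p q p' q' x := by
    rw [Φ.PLR_orth]
    simp only [and_comm]
  PLR_finite x := ((Φ.PLR_finite x).preimage Prod.swap_injective.injOn)
  PLR_total r x := by
    change Φ.g.P r x = _
    rw [Φ.PLR_total, ← finsum_comp_equiv (Equiv.subLeft r)]
    simp
  dLop := Φ.dRop
  dRop := Φ.dLop
  dLop_eq p q x := Φ.dRop_eq q p x
  dRop_eq p q x := Φ.dLop_eq q p x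
  DL := Φ.DR
  DR := Φ.DL
  single_valued p q x := by
    have h := Φ.single_valued q p x
    rw [← neg_sub, mul_neg, exp_neg]
    nth_rewrite 1 [← h]
    rw [smul_smul, inv_mul_cancel₀ (exp_ne_zero _), one_smul]
  m_conv2 k l u z0 z e h f := by
    have := Φ.m_conv2 k l u (fun i => (starRingEnd ℂ) (z0 i))
      (fun i j => (starRingEnd ℂ) (z i j)) e
      (fun i j hij p q => by simpa only [← map_sub, RCLike.norm_conj] using h i j hij p q) f
    let E : (Fin k → ℝ × ℝ) ≃ (Fin k → ℝ × ℝ) := Equiv.piCongrRight fun _ => Equiv.prodComm ℝ ℝ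
    rw [← E.summable_iff, ← E.tsum_eq] at this
    simpa only [map_add, E, Function.comp_def, Equiv.piCongrRight_apply, Pi.map_apply,
      Equiv.prodComm_apply, Prod.fst_swap, Prod.snd_swap, add_comm] using this
  dL_bracket u v f z hz := by
    simp only [FullFieldAlgebra.swap_Y]
    have h := Φ.dR_bracket u v f ((starRingEnd ℂ) z) ((map_ne_zero _).2 hz)
    rw [conj_conj] at h
    rw [wdz_comp_conj fun w => Φ.g.dpair f (Φ.toFullFieldAlgebra.Y u w v)]
    exact h
  dR_bracket u v f z hz := by
    simp only [FullFieldAlgebra.swap_Y]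
    have h := Φ.dL_bracket u v f ((starRingEnd ℂ) z) ((map_ne_zero _).2 hz)
    rw [wdzbar_comp_conj fun w => Φ.g.dpair f (Φ.toFullFieldAlgebra.Y u w v)]
    exact h
  DL_deriv u v f z hz := by
    simp only [FullFieldAlgebra.swap_Y]
    rw [wdz_comp_conj fun w => Φ.g.dpair f (Φ.toFullFieldAlgebra.Y u w v)]
    exact Φ.DR_deriv u v f _ ((map_ne_zero _).2 hz)
  DL_comm u v f z hz := by
    simp only [FullFieldAlgebra.swap_Y]
    exact Φ.DR_comm u v f _ ((map_ne_zero _).2 hz)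
  DR_deriv u v f z hz := by
    simp only [FullFieldAlgebra.swap_Y]
    rw [wdzbar_comp_conj fun w => Φ.g.dpair f (Φ.toFullFieldAlgebra.Y u w v)]
    exact Φ.DL_deriv u v f _ ((map_ne_zero _).2 hz)
  DR_comm u v f z hz := by
    simp only [FullFieldAlgebra.swap_Y]
    exact Φ.DL_comm u v f _ ((map_ne_zero _).2 hz)

lemma swap_modeTerm (Φ : RxRFFA) (l r : ℝ) (s : (ℝ × ℝ) × (ℝ × ℝ)) (u v : Φ.g.F) :
    Φ.swap.modeTerm l r s u v = Φ.modeTerm r l (s.1.swap, s.2.swap) u v := by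
  have h := Φ.toFullFieldAlgebra.swap_Y (Φ.PLR s.1.2 s.1.1 u) 1 (Φ.PLR s.2.2 s.2.1 v)
  rw [map_one] at h
  change Φ.PLR _ _ (Φ.toFullFieldAlgebra.swap.Y (Φ.PLR s.1.2 s.1.1 u) 1
    (Φ.PLR s.2.2 s.2.1 v) _) = Φ.PLR _ _ _
  rw [h, add_comm (s.1.1 + s.2.1 - l - 1)]
  rfl

lemma swap_Ymode (Φ : RxRFFA) (u : Φ.g.F) (l r : ℝ) (v : Φ.g.F) :
    Φ.swap.Ymode u l r v = Φ.Ymode u r l v := by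
  rw [Φ.Ymode_eq_finsum,
    ← finsum_comp_equiv ((Equiv.prodComm ℝ ℝ).prodCongr (Equiv.prodComm ℝ ℝ))]
  exact (Φ.swap.Ymode_eq_finsum u l r v).trans
    (finsum_congr fun s => Φ.swap_modeTerm l r s u v)

end RxRFFA

namespace ConfFFA

/-- The conformal full field algebra with the left and right structures exchanged. -/
def swap (Φ : ConfFFA) : ConfFFA where
  toRxRFFA := Φ.toRxRFFA.swap
  cL := Φ.cR
  cR := Φ.cL
  ωL := Φ.ωR
  ωR := Φ.ωL
  grading_res := ⟨Φ.grading_res.1.imp fun _ hM p q h => hM q p h.symm,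
    fun p q => Φ.grading_res.2 q p⟩
  ωL_modes l r h v := (Φ.toRxRFFA.swap_Ymode _ l r v).trans (Φ.ωR_modes r l h v)
  ωR_modes l r h v := (Φ.toRxRFFA.swap_Ymode _ l r v).trans (Φ.ωL_modes r l h v)
  LL := Φ.LR
  LR := Φ.LL
  LL_eq n v := (Φ.LR_eq n v).trans (Φ.toRxRFFA.swap_Ymode _ _ _ v).symm
  LR_eq n v := (Φ.LL_eq n v).trans (Φ.toRxRFFA.swap_Ymode _ _ _ v).symm
  virL := Φ.virR
  virR := Φ.virL
  virLR m n v := (Φ.virLR n m v).symm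
  dL_L0 := Φ.dR_L0
  dR_L0 := Φ.dL_L0
  DL_L1 := Φ.DR_L1
  DR_L1 := Φ.DL_L1

/-- The right commutator formula. -/
lemma commutator_right (Φ : ConfFFA) (u v : Φ.g.F) (mm : ℤ) (l r : ℝ) :
    Φ.LR mm (Φ.Ymode u l r v) - Φ.Ymode u l r (Φ.LR mm v)
      = ∑ᶠ i : ℕ, cchoose ((mm : ℂ) + 1) i •
          Φ.Ymode (Φ.LR ((i : ℤ) - 1) u) l (r + (mm : ℝ) + 1 - (i : ℝ)) v := by
  simp only [← Φ.toRxRFFA.swap_Ymode]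
  exact Φ.swap.commutator_left u v mm r l

end ConfFFA

/-- Proposition 1.? of Huang–Kong: in a conformal full field algebra the
commutator formulas
`[𝕐_f(ω^L; x₁, x̄₁), 𝕐_f(u; x₂, x̄₂)] = Res_{x₀} x₂⁻¹ δ((x₁-x₀)/x₂) 𝕐_f(𝕐_f(ω^L; x₀, x̄₀)u; x₂, x̄₂)`
and the analogous formula for `ω^R` hold.  (Stated here in the equivalent
component form: equating the coefficients of `x₁^{-m-2} x₂^{-l-1} x̄₂^{-r-1}` on both
sides of the delta-function identity gives exactly the identities below, with
`L^{L}(i-1) = (ω^L)_i`.) -/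
theorem cffa_virasoro_commutator (Φ : ConfFFA) (u v : Φ.g.F) :
    (∀ (mm : ℤ) (l r : ℝ),
      Φ.LL mm (Φ.Ymode u l r v) - Φ.Ymode u l r (Φ.LL mm v)
        = ∑ᶠ i : ℕ, cchoose ((mm : ℂ) + 1) i •
            Φ.Ymode (Φ.LL ((i : ℤ) - 1) u) (l + (mm : ℝ) + 1 - (i : ℝ)) r v) ∧
    (∀ (mm : ℤ) (l r : ℝ),
      Φ.LR mm (Φ.Ymode u l r v) - Φ.Ymode u l r (Φ.LR mm v)
        = ∑ᶠ i : ℕ, cchoose ((mm : ℂ) + 1) i •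
            Φ.Ymode (Φ.LR ((i : ℤ) - 1) u) l (r + (mm : ℝ) + 1 - (i : ℝ)) v) :=
  ⟨Φ.commutator_left u v, Φ.commutator_right u v⟩
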